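/- arXiv:1903.10738 — 8 statements merged into one kernel-verified Lean document; each statement's English description precedes it below -/
import Mathlib

section
/- Let 1 ≤ τ ≤ ρ ≤ ∞ with 1/ρ + 1/ρ' = 1/τ, and let λ = (λ_i)_{i∈ℕ} be positive reals with ‖λ‖_{ρ'} < ∞. Then the operator norm of the diagonal solution operator equals the ρ'-norm of the weights: sup { ‖(c_i)_{i∈ℕ}‖_τ : (c_i) real sequence with ‖(c_i/λ_i)_{i∈ℕ}‖_ρ ≤ 1 } = ‖(λ_i)_{i∈ℕ}‖_{ρ'}. -/
open scoped ENNReal NNReal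

/-- The `ℓ^p` norm (valued in `[0,∞]`) of a real sequence `a` restricted to an
index set `K ⊆ ℕ`, for an extended-real exponent `p`. -/
noncomputable def lpNorm (p : ℝ≥0∞) (K : Set ℕ) (a : ℕ → ℝ) : ℝ≥0∞ :=
  if p = ∞ then ⨆ k ∈ K, (‖a k‖₊ : ℝ≥0∞)
  else (∑' k : K, (‖a k‖₊ : ℝ≥0∞) ^ p.toReal) ^ (1 / p.toReal)

open MeasureTheory in
theorem lpNorm_eq_eLp (p : ℝ≥0∞) (hp : p ≠ 0) (a : ℕ → ℝ) :
    lpNorm p Set.univ a = eLpNorm a p Measure.count := by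
  unfold _root_.lpNorm
  split_ifs with h
  · subst h
    simp [eLpNorm_exponent_top, eLpNormEssSup, enorm_eq_nnnorm]
  · rw [eLpNorm_eq_lintegral_rpow_enorm_toReal hp h, lintegral_count,
      tsum_univ (fun k => (‖a k‖₊ : ℝ≥0∞) ^ p.toReal)]
    rfl

theorem lpNorm_of_pos (p : ℝ≥0∞) (hp : p ≠ ∞) (a : ℕ → ℝ) (ha : ∀ i, 0 < a i) :
    lpNorm p Set.univ a = (∑' k, ENNReal.ofReal (a k ^ p.toReal)) ^ (1 / p.toReal) := by
  unfold lpNorm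
  rw [if_neg hp, tsum_univ (fun k => (‖a k‖₊ : ℝ≥0∞) ^ p.toReal)]
  congr 2
  ext k
  rw [← enorm_eq_nnnorm, Real.enorm_of_nonneg (ha k).le, ENNReal.ofReal_rpow_of_pos (ha k)]

theorem lpNorm_single (p : ℝ≥0∞) (hp : p ≠ 0) (k : ℕ) (x : ℝ) :
    lpNorm p Set.univ (Pi.single k x) = ENNReal.ofReal |x| := by
  have key : ∀ r : ℝ, 0 < r → ∀ i, (‖(Pi.single k x : ℕ → ℝ) i‖₊ : ℝ≥0∞) ^ r =
      if i = k then ENNReal.ofReal |x| ^ r else 0 := by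
    intro r hr i
    by_cases h : i = k
    · subst h
      simp [← enorm_eq_nnnorm, Real.enorm_eq_ofReal_abs]
    · simp [h, hr]
  unfold lpNorm
  split_ifs with h
  · have := key 1 one_pos
    simp only [ENNReal.rpow_one] at this
    simp only [this, Set.mem_univ, iSup_pos]
    refine le_antisymm (iSup_le fun i => ?_) (le_iSup_of_le k (by simp))
    split_ifs <;> simp
  · have hr := ENNReal.toReal_pos hp h
    rw [tsum_univ (fun i => (‖(Pi.single k x : ℕ → ℝ) i‖₊ : ℝ≥0∞) ^ p.toReal)]
    simp_rw [key _ hr]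
    rw [tsum_ite_eq, ← ENNReal.rpow_mul, mul_one_div_cancel hr.ne', ENNReal.rpow_one]

theorem lower_main (τ ρ ρ' : ℝ≥0∞) (hτ0 : τ ≠ 0) (hρ0 : ρ ≠ 0) (hρ'0 : ρ' ≠ 0)
    (hτt : τ ≠ ∞) (hρt : ρ ≠ ∞) (hρ't : ρ' ≠ ∞)
    (hconj : 1 / ρ + 1 / ρ' = 1 / τ)
    (lam : ℕ → ℝ) (hlam : ∀ i, 0 < lam i)
    (hΛfin : lpNorm ρ' Set.univ lam ≠ ∞) :
    ∃ c : ℕ → ℝ, lpNorm ρ Set.univ (fun i => c i / lam i) ≤ 1 ∧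
      lpNorm ρ' Set.univ lam ≤ lpNorm τ Set.univ c := by
  have ht := ENNReal.toReal_pos hτ0 hτt
  have hr := ENNReal.toReal_pos hρ0 hρt
  have hr' := ENNReal.toReal_pos hρ'0 hρ't
  have hc : 1 / ρ.toReal + 1 / ρ'.toReal = 1 / τ.toReal := by
    have := congrArg ENNReal.toReal hconj
    rw [ENNReal.toReal_add (by simpa using hρ0) (by simpa using hρ'0)] at this
    simpa using this
  rw [lpNorm_of_pos ρ' hρ't lam hlam] at hΛfin ⊢
  have hS : ∑' k, ENNReal.ofReal (lam k ^ ρ'.toReal) ≠ ∞ := by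
    intro h
    rw [h] at hΛfin
    exact hΛfin (ENNReal.top_rpow_of_pos (by positivity))
  have hS0 : ∑' k, ENNReal.ofReal (lam k ^ ρ'.toReal) ≠ 0 := by
    intro h
    have := ENNReal.tsum_eq_zero.1 h 0
    rw [ENNReal.ofReal_eq_zero] at this
    exact absurd this (not_le.2 (Real.rpow_pos_of_pos (hlam 0) _))
  obtain ⟨s, hs⟩ : ∃ s : ℝ, s = (∑' k, ENNReal.ofReal (lam k ^ ρ'.toReal)).toReal := ⟨_, rfl⟩
  have hspos : 0 < s := hs ▸ ENNReal.toReal_pos hS0 hS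
  have hSs : ∑' k, ENNReal.ofReal (lam k ^ ρ'.toReal) = ENNReal.ofReal s := by
    rw [hs, ENNReal.ofReal_toReal hS]
  have hdpos : ∀ i, 0 < lam i ^ (ρ'.toReal / ρ.toReal) * s ^ (-(1 / ρ.toReal)) := fun i =>
    mul_pos (Real.rpow_pos_of_pos (hlam i) _) (Real.rpow_pos_of_pos hspos _)
  refine ⟨fun i => lam i ^ (ρ'.toReal / ρ.toReal) * s ^ (-(1 / ρ.toReal)) * lam i, ?_, ?_⟩
  · have he : (fun i => lam i ^ (ρ'.toReal / ρ.toReal) * s ^ (-(1 / ρ.toReal)) * lam i / lam i) =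
        fun i => lam i ^ (ρ'.toReal / ρ.toReal) * s ^ (-(1 / ρ.toReal)) := by
      ext i
      exact mul_div_cancel_right₀ _ (hlam i).ne'
    rw [he, lpNorm_of_pos ρ hρt _ hdpos]
    have hk : ∀ k, ENNReal.ofReal
        ((lam k ^ (ρ'.toReal / ρ.toReal) * s ^ (-(1 / ρ.toReal))) ^ ρ.toReal) =
        ENNReal.ofReal (lam k ^ ρ'.toReal) * ENNReal.ofReal s⁻¹ := by
      intro k
      rw [← ENNReal.ofReal_mul (Real.rpow_nonneg (hlam k).le _),
        Real.mul_rpow (Real.rpow_nonneg (hlam k).le _) (Real.rpow_nonneg hspos.le _),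
        ← Real.rpow_mul (hlam k).le, ← Real.rpow_mul hspos.le, div_mul_cancel₀ _ hr.ne',
        neg_mul, one_div_mul_cancel hr.ne', Real.rpow_neg_one]
    simp_rw [hk]
    rw [ENNReal.tsum_mul_right, hSs, ← ENNReal.ofReal_mul hspos.le, mul_inv_cancel₀ hspos.ne']
    simp
  · rw [lpNorm_of_pos τ hτt _ (fun i => mul_pos (hdpos i) (hlam i)), hSs]
    have e1 : (ρ'.toReal / ρ.toReal + 1) * τ.toReal = ρ'.toReal := by
      have : ρ'.toReal / ρ.toReal + 1 = ρ'.toReal * (1 / ρ.toReal + 1 / ρ'.toReal) := by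
        field_simp
      rw [this, hc]
      field_simp
    have hk : ∀ k, ENNReal.ofReal
        ((lam k ^ (ρ'.toReal / ρ.toReal) * s ^ (-(1 / ρ.toReal)) * lam k) ^ τ.toReal) =
        ENNReal.ofReal (lam k ^ ρ'.toReal) *
          ENNReal.ofReal (s ^ (-(1 / ρ.toReal) * τ.toReal)) := by
      intro k
      rw [← ENNReal.ofReal_mul (Real.rpow_nonneg (hlam k).le _), mul_right_comm,
        Real.mul_rpow (mul_nonneg (Real.rpow_nonneg (hlam k).le _) (hlam k).le)
          (Real.rpow_nonneg hspos.le _),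
        ← Real.rpow_add_one (hlam k).ne', ← Real.rpow_mul (hlam k).le, e1,
        ← Real.rpow_mul hspos.le]
    simp_rw [hk]
    rw [ENNReal.tsum_mul_right, hSs, ← ENNReal.ofReal_mul hspos.le, mul_comm s,
      ← Real.rpow_add_one hspos.ne', ENNReal.ofReal_rpow_of_pos hspos,
      ENNReal.ofReal_rpow_of_pos (Real.rpow_pos_of_pos hspos _), ← Real.rpow_mul hspos.le]
    have e2 : (-(1 / ρ.toReal) * τ.toReal + 1) * (1 / τ.toReal) = 1 / ρ'.toReal := by
      have : (-(1 / ρ.toReal) * τ.toReal + 1) * (1 / τ.toReal) =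
          1 / τ.toReal - 1 / ρ.toReal := by
        field_simp
        ring
      rw [this, ← hc]
      ring
    rw [e2]

/-- The operator norm of the diagonal solution operator equals the `ρ'`-norm of
the weights: `sup { ‖c‖_τ : ‖(c_i/λ_i)‖_ρ ≤ 1 } = ‖λ‖_{ρ'}`. -/
theorem sol_operator_norm (τ ρ ρ' : ℝ≥0∞) (hτ : 1 ≤ τ) (hτρ : τ ≤ ρ)
    (hconj : 1 / ρ + 1 / ρ' = 1 / τ)
    (lam : ℕ → ℝ) (hlam : ∀ i, 0 < lam i)
    (hΛfin : lpNorm ρ' Set.univ lam ≠ ∞) :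
    ⨆ c ∈ {c : ℕ → ℝ | lpNorm ρ Set.univ (fun i => c i / lam i) ≤ 1},
      lpNorm τ Set.univ c = lpNorm ρ' Set.univ lam := by
  have hτ0 : τ ≠ 0 := (zero_lt_one.trans_le hτ).ne'
  have hρ0 : ρ ≠ 0 := (zero_lt_one.trans_le (hτ.trans hτρ)).ne'
  have hρ'0 : ρ' ≠ 0 := by
    rintro rfl
    simp at hconj
    exact hτ0 (ENNReal.inv_eq_top.1 hconj.symm)
  apply le_antisymm
  · refine iSup₂_le fun c hc => ?_
    have hc' : lpNorm ρ Set.univ (fun i => c i / lam i) ≤ 1 := hc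
    have : ENNReal.HolderTriple ρ ρ' τ := ⟨by simpa using hconj⟩
    have hh := MeasureTheory.eLpNorm_smul_le_mul_eLpNorm (p := ρ) (q := ρ') (r := τ)
      (μ := MeasureTheory.Measure.count) (f := lam) (φ := fun i => c i / lam i)
      (by fun_prop) (Measurable.of_discrete.aestronglyMeasurable)
    have he : (fun i => c i / lam i) • lam = c := by
      ext i
      simp [(hlam i).ne']
    rw [he, ← lpNorm_eq_eLp _ hτ0, ← lpNorm_eq_eLp _ hρ0, ← lpNorm_eq_eLp _ hρ'0] at hh
    exact hh.trans (mul_le_of_le_one_left' hc')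
  · by_cases hρ't : ρ' = ∞
    · have : lpNorm ρ' Set.univ lam = ⨆ k, ENNReal.ofReal (lam k) := by
        simp only [lpNorm, hρ't, if_true, Set.mem_univ, iSup_pos]
        congr 1
        ext k
        rw [← enorm_eq_nnnorm, Real.enorm_of_nonneg (hlam k).le]
      rw [this]
      refine iSup_le fun k => ?_
      refine le_iSup₂_of_le (Pi.single k (lam k)) ?_ ?_
      · have : (fun i => (Pi.single k (lam k) : ℕ → ℝ) i / lam i) = Pi.single k 1 := by
          ext i
          by_cases h : i = k
          · subst h
            simp [(hlam i).ne']
          · simp [h]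
        simp only [Set.mem_ofPred_eq]
        rw [this, lpNorm_single _ hρ0]
        simp
      · rw [lpNorm_single _ hτ0, abs_of_pos (hlam k)]
    · by_cases hρt : ρ = ∞
      · have hE : ρ' = τ := by
          subst hρt
          simpa using hconj
        refine le_iSup₂_of_le lam ?_ (by rw [hE])
        have : (fun i => lam i / lam i) = fun _ => (1 : ℝ) := by
          ext i
          exact div_self (hlam i).ne'
        simp only [Set.mem_ofPred_eq]
        rw [this]
        simp [lpNorm, hρt]
      · obtain ⟨c, h1, h2⟩ := lower_main τ ρ ρ' hτ0 hρ0 hρ'0 (ne_top_of_le_ne_top hρt hτρ) hρt hρ't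
          hconj lam hlam hΛfin
        exact le_iSup₂_of_le c h1 h2
end

section
/- Theorem (lower bound for arbitrary approximations from n coefficients): Let 1 ≤ τ ≤ ρ ≤ ∞ with 1/ρ + 1/ρ' = 1/τ, let λ = (λ_i)_{i∈ℕ} be positive, nonincreasing with ‖λ‖_{ρ'} < ∞, and let R > 0. Let J ⊆ ℕ be finite with card(J) = n, and let φ be any map from real sequences to real sequences such that φ(c) = φ(c') whenever c_j = c'_j for all j ∈ J (i.e., φ uses only the coefficients indexed by J). Then sup { ‖(c_i − φ(c)_i)_{i∈ℕ}‖_τ : ‖(c_i/λ_i)_i‖_ρ ≤ R } ≥ R · ‖(λ_i)_{i∉J}‖_{ρ'} ≥ R · ‖(λ_i)_{i=n+1}^∞‖_{ρ'}. -/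
open scoped ENNReal NNReal

lemma aux_minkowski (p : ℝ≥0∞) (hp : 1 ≤ p) (a b d : ℕ → ℝ)
    (h : ∀ i, 2 * (‖a i‖₊ : ℝ≥0∞) ≤ ‖b i‖₊ + ‖d i‖₊) :
    2 * lpNorm p Set.univ a ≤ lpNorm p Set.univ b + lpNorm p Set.univ d := by
  unfold lpNorm
  split_ifs with hp'
  · rw [ENNReal.mul_iSup]
    refine iSup_le fun i => ?_
    simp only [Set.mem_univ, iSup_pos]
    exact (h i).trans (add_le_add (le_iSup (fun k => (‖b k‖₊ : ℝ≥0∞)) i)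
      (le_iSup (fun k => (‖d k‖₊ : ℝ≥0∞)) i))
  · have h1 : 1 ≤ p.toReal := by
      rw [← ENNReal.toReal_one]; exact (ENNReal.toReal_le_toReal (by simp) hp').2 hp
    have h0 : 0 < p.toReal := by linarith
    have hu : ∀ f : ℕ → ℝ≥0∞, ∑' k : (Set.univ : Set ℕ), f k = ∑' k, f k := fun f => tsum_univ f
    rw [hu (fun k => (‖a k‖₊ : ℝ≥0∞) ^ p.toReal), hu (fun k => (‖b k‖₊ : ℝ≥0∞) ^ p.toReal),
      hu (fun k => (‖d k‖₊ : ℝ≥0∞) ^ p.toReal)]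
    have key := ENNReal.lintegral_Lp_add_le (μ := MeasureTheory.Measure.count)
      (f := fun i : ℕ => (‖b i‖₊ : ℝ≥0∞)) (g := fun i : ℕ => (‖d i‖₊ : ℝ≥0∞))
      (measurable_of_countable _).aemeasurable (measurable_of_countable _).aemeasurable h1
    simp only [MeasureTheory.lintegral_count, Pi.add_apply] at key
    refine le_trans ?_ key
    have e2 : (2 : ℝ≥0∞) = ((2 : ℝ≥0∞) ^ p.toReal) ^ (1 / p.toReal) := by
      rw [← ENNReal.rpow_mul, mul_one_div_cancel h0.ne', ENNReal.rpow_one]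
    rw [e2, ← ENNReal.mul_rpow_of_nonneg _ _ (by positivity), ← ENNReal.tsum_mul_left]
    gcongr with i
    rw [← ENNReal.mul_rpow_of_nonneg _ _ h0.le]
    gcongr
    exact h i

lemma aux_single (p : ℝ≥0∞) (hp : 1 ≤ p) (k : ℕ) (x : ℝ) :
    lpNorm p Set.univ (Pi.single k x) = ‖x‖₊ := by
  unfold lpNorm
  split_ifs with hp'
  · apply le_antisymm
    · refine iSup₂_le fun i _ => ?_
      by_cases hi : i = k
      · subst hi; simp
      · simp [hi]
    · refine le_trans ?_ (le_iSup₂ (f := fun i (_ : i ∈ (Set.univ : Set ℕ)) =>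
        (‖(Pi.single k x : ℕ → ℝ) i‖₊ : ℝ≥0∞)) k (Set.mem_univ k))
      simp
  · have h1 : 1 ≤ p.toReal := by
      rw [← ENNReal.toReal_one]; exact (ENNReal.toReal_le_toReal (by simp) hp').2 hp
    have h0 : 0 < p.toReal := by linarith
    rw [tsum_univ (fun i => (‖(Pi.single k x : ℕ → ℝ) i‖₊ : ℝ≥0∞) ^ p.toReal), tsum_eq_single k]
    · rw [Pi.single_eq_same, ← ENNReal.rpow_mul, mul_one_div_cancel h0.ne', ENNReal.rpow_one]
    · intro b hb
      simp [hb, h0]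

lemma aux_indicator (p : ℝ≥0∞) (hp : 1 ≤ p) (hp' : p ≠ ∞) (K : Set ℕ) (lam : ℕ → ℝ)
    (hpos : ∀ i, 0 < lam i) (A : ℝ) (hA : 0 ≤ A) (q : ℝ) (t : ℝ) (ht : q * p.toReal = t) :
    lpNorm p Set.univ (K.indicator fun i => A * lam i ^ q) =
      ENNReal.ofReal A * (∑' k : K, (‖lam k‖₊ : ℝ≥0∞) ^ t) ^ (1 / p.toReal) := by
  have h1 : 1 ≤ p.toReal := by
    rw [← ENNReal.toReal_one]; exact (ENNReal.toReal_le_toReal (by simp) hp').2 hp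
  have h0 : 0 < p.toReal := by linarith
  have e2 : ENNReal.ofReal A = (ENNReal.ofReal A ^ p.toReal) ^ (1 / p.toReal) := by
    rw [← ENNReal.rpow_mul, mul_one_div_cancel h0.ne', ENNReal.rpow_one]
  rw [lpNorm, if_neg hp', e2, ← ENNReal.mul_rpow_of_nonneg _ _ (by positivity),
    ← ENNReal.tsum_mul_left]
  congr 1
  rw [tsum_univ (fun i => (‖(K.indicator fun i => A * lam i ^ q) i‖₊ : ℝ≥0∞) ^ p.toReal),
    tsum_subtype K (fun i => ENNReal.ofReal A ^ p.toReal * (‖lam i‖₊ : ℝ≥0∞) ^ t)]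
  congr 1
  ext i
  by_cases hi : i ∈ K
  · rw [Set.indicator_of_mem hi, Set.indicator_of_mem hi]
    have hl : (‖lam i‖₊ : ℝ≥0∞) = ENNReal.ofReal (lam i) := by
      rw [← Real.enorm_of_nonneg (hpos i).le]; rfl
    have hl2 : (‖A * lam i ^ q‖₊ : ℝ≥0∞) = ENNReal.ofReal (A * lam i ^ q) := by
      rw [← Real.enorm_of_nonneg (mul_nonneg hA (Real.rpow_nonneg (hpos i).le _))]; rfl
    rw [hl, hl2, ENNReal.ofReal_mul hA, ← ENNReal.ofReal_rpow_of_pos (hpos i),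
      ENNReal.mul_rpow_of_nonneg _ _ h0.le, ← ENNReal.rpow_mul, ht]
  · rw [Set.indicator_of_notMem hi, Set.indicator_of_notMem hi]
    simp [h0]

lemma aux_inj (J : Finset ℕ) : ∃ e : ℕ → ℕ, Function.Injective e ∧
    ∀ m, e m ∉ J ∧ e m ≤ m + J.card := by
  classical
  have hinf : (setOf fun i => i ∉ J).Infinite := J.finite_toSet.infinite_compl
  refine ⟨Nat.nth (fun i => i ∉ J), Nat.nth_injective hinf, fun m => ⟨Nat.nth_mem_of_infinite hinf m, ?_⟩⟩
  have hc : m < Nat.count (fun i => i ∉ J) (m + J.card + 1) := by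
    rw [Nat.count_eq_card_filter_range]
    have h1 := Finset.card_filter_add_card_filter_not (s := Finset.range (m + J.card + 1)) (fun i => i ∈ J)
    have h2 : ((Finset.range (m + J.card + 1)).filter (fun i => i ∈ J)).card ≤ J.card :=
      Finset.card_le_card (fun x hx => (Finset.mem_filter.1 hx).2)
    rw [Finset.card_range] at h1
    omega
  exact Nat.lt_succ_iff.1 (Nat.nth_lt_of_lt_count hc)

lemma aux_second (p : ℝ≥0∞) (lam : ℕ → ℝ) (hpos : ∀ i, 0 < lam i) (hanti : Antitone lam)
    (J : Finset ℕ) : lpNorm p {i | J.card ≤ i} lam ≤ lpNorm p {i | i ∉ J} lam := by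
  obtain ⟨e, he, hJ⟩ := aux_inj J
  have hle : ∀ i, J.card ≤ i → (‖lam i‖₊ : ℝ≥0∞) ≤ ‖lam (e (i - J.card))‖₊ := by
    intro i hi
    have h1 : e (i - J.card) ≤ i := by have := (hJ (i - J.card)).2; omega
    have h2 := hanti h1
    rw [ENNReal.coe_le_coe, ← NNReal.coe_le_coe, coe_nnnorm, coe_nnnorm,
      Real.norm_of_nonneg (hpos _).le, Real.norm_of_nonneg (hpos _).le]
    exact h2
  unfold lpNorm
  split_ifs with hp
  · refine iSup₂_le fun i hi => (hle i hi).trans ?_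
    exact le_iSup₂ (f := fun i (_ : i ∈ {i | i ∉ J}) => (‖lam i‖₊ : ℝ≥0∞)) _ (hJ _).1
  · gcongr ?_ ^ _
    let g : {i | J.card ≤ i} → {i | i ∉ J} := fun i => ⟨e (i - J.card), (hJ _).1⟩
    have hg : Function.Injective g := by
      rintro ⟨i, hi⟩ ⟨j, hj⟩ h
      have := he (Subtype.mk.inj h)
      simp only [Set.mem_setOf_eq] at hi hj
      apply Subtype.ext
      simp only at this ⊢
      omega
    refine le_trans ?_ (ENNReal.tsum_comp_le_tsum_of_injective hg
      (fun k => (‖lam k‖₊ : ℝ≥0∞) ^ p.toReal))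
    refine ENNReal.tsum_le_tsum fun i => ?_
    gcongr
    exact ENNReal.coe_le_coe.1 (hle i i.2)

lemma aux_key (τ ρ : ℝ≥0∞) (hτ : 1 ≤ τ) (lam : ℕ → ℝ) (R : ℝ) (J : Finset ℕ)
    (φ : (ℕ → ℝ) → (ℕ → ℝ))
    (hφ : ∀ c c' : ℕ → ℝ, (∀ j ∈ J, c j = c' j) → φ c = φ c') (c : ℕ → ℝ)
    (hc : ∀ j ∈ J, c j = 0)
    (hcR : lpNorm ρ Set.univ (fun i => c i / lam i) ≤ ENNReal.ofReal R) :
    lpNorm τ Set.univ c ≤ (⨆ c ∈ {c : ℕ → ℝ |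
          lpNorm ρ Set.univ (fun i => c i / lam i) ≤ ENNReal.ofReal R},
        lpNorm τ Set.univ (fun i => c i - φ c i)) := by
  set M := (⨆ c ∈ {c : ℕ → ℝ |
          lpNorm ρ Set.univ (fun i => c i / lam i) ≤ ENNReal.ofReal R},
        lpNorm τ Set.univ (fun i => c i - φ c i)) with hM
  have hle : ∀ c : ℕ → ℝ, lpNorm ρ Set.univ (fun i => c i / lam i) ≤ ENNReal.ofReal R →
      lpNorm τ Set.univ (fun i => c i - φ c i) ≤ M := fun c h =>
    le_iSup₂ (f := fun (c : ℕ → ℝ) (_ : c ∈ {c : ℕ → ℝ |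
          lpNorm ρ Set.univ (fun i => c i / lam i) ≤ ENNReal.ofReal R}) =>
        lpNorm τ Set.univ (fun i => c i - φ c i)) c h
  have hneg : lpNorm ρ Set.univ (fun i => (-c) i / lam i) ≤ ENNReal.ofReal R := by
    refine le_of_eq_of_le ?_ hcR
    simp only [lpNorm, Pi.neg_apply, neg_div, nnnorm_neg]
  have hφe : φ (-c) = φ c := hφ _ _ fun j hj => by simp [hc j hj]
  have h1 := hle c hcR
  have h2 := hle (-c) hneg
  have h3 := aux_minkowski τ hτ c (fun i => c i - φ c i) (fun i => (-c) i - φ (-c) i) (by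
    intro i
    rw [hφe]
    have : 2 * ‖c i‖₊ ≤ ‖c i - φ c i‖₊ + ‖(-c) i - φ c i‖₊ := by
      rw [← NNReal.coe_le_coe]
      push_cast
      have := norm_sub_le (c i - φ c i) ((-c) i - φ c i)
      have e : (c i - φ c i) - ((-c) i - φ c i) = 2 * c i := by simp; ring
      rw [e, norm_mul] at this
      simpa using this
    exact_mod_cast this)
  have h4 : 2 * lpNorm τ Set.univ c ≤ 2 * M := by
    rw [two_mul M]; exact h3.trans (add_le_add h1 h2)
  exact (ENNReal.mul_le_mul_iff_right (by simp) (by simp)).1 h4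

/-- Lower bound for arbitrary approximations using only the `n` coefficients
indexed by a finite set `J`: the worst-case error over the ball of radius `R`
is at least `R ‖(λ_i)_{i∉J}‖_{ρ'} ≥ R ‖(λ_i)_{i≥n}‖_{ρ'}`. -/
theorem arbitrary_app_lower_bound (τ ρ ρ' : ℝ≥0∞) (hτ : 1 ≤ τ) (hτρ : τ ≤ ρ)
    (hconj : 1 / ρ + 1 / ρ' = 1 / τ)
    (lam : ℕ → ℝ) (hpos : ∀ i, 0 < lam i) (hanti : Antitone lam)
    (hΛfin : lpNorm ρ' Set.univ lam ≠ ∞)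
    (R : ℝ) (hR : 0 < R)
    (J : Finset ℕ) (n : ℕ) (hJ : J.card = n)
    (φ : (ℕ → ℝ) → (ℕ → ℝ))
    (hφ : ∀ c c' : ℕ → ℝ, (∀ j ∈ J, c j = c' j) → φ c = φ c') :
    ENNReal.ofReal R * lpNorm ρ' {i | i ∉ J} lam ≤
      (⨆ c ∈ {c : ℕ → ℝ |
          lpNorm ρ Set.univ (fun i => c i / lam i) ≤ ENNReal.ofReal R},
        lpNorm τ Set.univ (fun i => c i - φ c i)) ∧
    ENNReal.ofReal R * lpNorm ρ' {i | n ≤ i} lam ≤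
      ENNReal.ofReal R * lpNorm ρ' {i | i ∉ J} lam := by
  subst hJ
  refine ⟨?_, mul_le_mul_right (aux_second ρ' lam hpos hanti J) _⟩
  have key := aux_key τ ρ hτ lam R J φ hφ
  set M := (⨆ c ∈ {c : ℕ → ℝ |
          lpNorm ρ Set.univ (fun i => c i / lam i) ≤ ENNReal.ofReal R},
        lpNorm τ Set.univ (fun i => c i - φ c i)) with hM
  have hρ : 1 ≤ ρ := hτ.trans hτρ
  have hofR : (‖R‖₊ : ℝ≥0∞) = ENNReal.ofReal R := by
    rw [← Real.enorm_of_nonneg hR.le]; rfl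
  by_cases hρ' : ρ' = ∞
  · rw [lpNorm, if_pos hρ', ENNReal.mul_iSup]
    refine iSup_le fun k => ?_
    rw [ENNReal.mul_iSup]
    refine iSup_le fun hk => ?_
    have h1 := key (Pi.single k (R * lam k)) (by
      intro j hj
      have : j ≠ k := fun h => hk (h ▸ hj)
      simp [this]) (by
      have : (fun i => (Pi.single k (R * lam k) : ℕ → ℝ) i / lam i) = Pi.single k R := by
        ext i
        by_cases hi : i = k
        · subst hi; simp [(hpos i).ne']
        · simp [hi]
      rw [this, aux_single ρ hρ, hofR])
    rw [aux_single τ hτ, nnnorm_mul, ENNReal.coe_mul, hofR] at h1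
    exact h1
  · have hτ' : τ ≠ ∞ := by
      rintro rfl
      simp at hconj
      exact hρ' hconj.2
    have hρ'1 : 1 ≤ ρ' := by
      have h1 : 1 / ρ' ≤ 1 / τ := hconj ▸ le_add_self
      simp only [one_div, ENNReal.inv_le_inv] at h1
      exact hτ.trans h1
    have hρ'0 : 0 < ρ'.toReal := ENNReal.toReal_pos (by rintro rfl; simp at hρ'1) hρ'
    have hτ0 : 0 < τ.toReal := ENNReal.toReal_pos (by rintro rfl; simp at hτ) hτ'
    have hreal : ρ.toReal⁻¹ + ρ'.toReal⁻¹ = τ.toReal⁻¹ := by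
      have := congrArg ENNReal.toReal hconj
      simp only [one_div] at this
      rw [ENNReal.toReal_add (by simp; rintro rfl; simp at hρ)
        (by simp; rintro rfl; simp at hρ'1)] at this
      simpa [ENNReal.toReal_inv] using this
    set K : Set ℕ := {i | i ∉ J} with hK
    set S : ℝ≥0∞ := ∑' k : K, (‖lam k‖₊ : ℝ≥0∞) ^ ρ'.toReal with hS
    have hSfin : S ≠ ∞ := by
      intro h
      apply hΛfin
      rw [lpNorm, if_neg hρ', tsum_univ (fun k => (‖lam k‖₊ : ℝ≥0∞) ^ ρ'.toReal)]
      have h2 : S ≤ ∑' k, (‖lam k‖₊ : ℝ≥0∞) ^ ρ'.toReal :=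
        ENNReal.tsum_comp_le_tsum_of_injective Subtype.val_injective
          (fun k => (‖lam k‖₊ : ℝ≥0∞) ^ ρ'.toReal)
      rw [h, top_le_iff] at h2
      rw [h2]
      exact ENNReal.top_rpow_of_pos (by positivity)
    have hS0 : S ≠ 0 := by
      obtain ⟨k, hk⟩ := J.exists_notMem
      intro h
      rw [hS, ENNReal.tsum_eq_zero] at h
      have := h ⟨k, hk⟩
      simp [hρ'0, (hpos k).ne', hρ'0.le] at this
    have hs : 0 < S.toReal := ENNReal.toReal_pos hS0 hSfin
    set r : ℝ := ρ'.toReal * ρ.toReal⁻¹ with hr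
    set A : ℝ := R * S.toReal ^ (-ρ.toReal⁻¹) with hA
    have hA0 : 0 ≤ A := by positivity
    have hAe : ENNReal.ofReal A = ENNReal.ofReal R * S ^ (-ρ.toReal⁻¹) := by
      rw [hA, ENNReal.ofReal_mul hR.le, ← ENNReal.ofReal_rpow_of_pos hs, ENNReal.ofReal_toReal hSfin]
    have h1 := key (K.indicator fun i => A * lam i ^ (1 + r)) (by
      intro j hj
      exact Set.indicator_of_notMem (by simpa [hK] using hj) _) (by
      have : (fun i => (K.indicator fun i => A * lam i ^ (1 + r)) i / lam i) =
          K.indicator fun i => A * lam i ^ r := by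
        ext i
        by_cases hi : i ∈ K
        · rw [Set.indicator_of_mem hi, Set.indicator_of_mem hi, Real.rpow_add (hpos i),
            Real.rpow_one]
          have := (hpos i).ne'
          field_simp
        · rw [Set.indicator_of_notMem hi, Set.indicator_of_notMem hi, zero_div]
      rw [this]
      by_cases hρt : ρ = ∞
      · rw [lpNorm, if_pos hρt]
        refine iSup₂_le fun i _ => ?_
        have hr0 : r = 0 := by simp [hr, hρt]
        have hAR : A = R := by simp [hA, hρt]
        by_cases hi : i ∈ K
        · rw [Set.indicator_of_mem hi, hr0, hAR, Real.rpow_zero, mul_one, hofR]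
        · rw [Set.indicator_of_notMem hi]; simp
      · have hρ0 : 0 < ρ.toReal := ENNReal.toReal_pos (by rintro rfl; simp at hρ) hρt
        rw [aux_indicator ρ hρ hρt K lam hpos A hA0 r ρ'.toReal (by rw [hr]; field_simp), ← hS, hAe,
          mul_assoc, ← ENNReal.rpow_add _ _ hS0 hSfin]
        simp)
    have hexp : (1 + r) * τ.toReal = ρ'.toReal := by
      have : 1 + r = ρ'.toReal * τ.toReal⁻¹ := by
        rw [← hreal, hr, mul_add, mul_inv_cancel₀ hρ'0.ne']; ring
      rw [this]; field_simp
    rw [aux_indicator τ hτ hτ' K lam hpos A hA0 (1 + r) ρ'.toReal hexp, ← hS, hAe,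
      mul_assoc, ← ENNReal.rpow_add _ _ hS0 hSfin] at h1
    rw [lpNorm, if_neg hρ', ← hS]
    have : 1 / ρ'.toReal = -ρ.toReal⁻¹ + 1 / τ.toReal := by
      rw [one_div, one_div, ← hreal]; ring
    rw [this]
    exact h1
end

section
/- Data-driven error bound for the pilot-sample algorithm: Let 1 ≤ τ ≤ ρ < ∞ with 1/ρ + 1/ρ' = 1/τ, let λ = (λ_i)_{i∈ℕ} be positive, nonincreasing with ‖λ‖_{ρ'} < ∞, let A > 1 and n₁ ∈ ℕ. If c lies in the pilot cone C, i.e., ‖(c_i/λ_i)_{i∈ℕ}‖_ρ ≤ A ‖(c_i/λ_i)_{i=1}^{n₁}‖_ρ, then for every n ≥ n₁ the approximation error satisfies ‖(c_i)_{i>n}‖_τ ≤ ERR(c,n), where ERR(c,n) := [ A^ρ ‖(c_i/λ_i)_{i=1}^{n₁}‖_ρ^ρ − ‖(c_i/λ_i)_{i=1}^{n}‖_ρ^ρ ]^{1/ρ} · ‖(λ_i)_{i=n+1}^∞‖_{ρ'}. -/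
open scoped ENNReal NNReal

/-- The data-driven error bound of the pilot-sample algorithm:
`ERR(c,n) = [A^ρ ‖(c_i/λ_i)_{i<n₁}‖_ρ^ρ − ‖(c_i/λ_i)_{i<n}‖_ρ^ρ]^{1/ρ} ⬝ ‖(λ_i)_{i≥n}‖_{ρ'}`. -/
noncomputable def ERR (ρ ρ' : ℝ≥0∞) (lam : ℕ → ℝ) (A : ℝ) (n₁ n : ℕ)
    (c : ℕ → ℝ) : ℝ≥0∞ :=
  (ENNReal.ofReal A ^ ρ.toReal *
      lpNorm ρ {i | i < n₁} (fun i => c i / lam i) ^ ρ.toReal -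
    lpNorm ρ {i | i < n} (fun i => c i / lam i) ^ ρ.toReal) ^ (1 / ρ.toReal) *
    lpNorm ρ' {i | n ≤ i} lam

theorem lpNorm_rpow_aux (p : ℝ≥0∞) (hp : p ≠ ∞) (hp0 : p ≠ 0) (K : Set ℕ) (a : ℕ → ℝ) :
    lpNorm p K a ^ p.toReal = ∑' k : K, (‖a k‖₊ : ℝ≥0∞) ^ p.toReal := by
  have h : p.toReal ≠ 0 := (ENNReal.toReal_pos hp0 hp).ne'
  rw [lpNorm, if_neg hp, ← ENNReal.rpow_mul, one_div, inv_mul_cancel₀ h, ENNReal.rpow_one]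

theorem lpNorm_holder_aux (τ ρ ρ' : ℝ≥0∞) (hτ : 1 ≤ τ) (hτρ : τ ≤ ρ)
    (hρfin : ρ ≠ ∞) (hconj : 1 / ρ + 1 / ρ' = 1 / τ) (K : Set ℕ)
    (a b c : ℕ → ℝ) (hc : ∀ i, c i = a i * b i) :
    lpNorm τ K c ≤ lpNorm ρ K a * lpNorm ρ' K b := by
  have hτfin : τ ≠ ∞ := ne_top_of_le_ne_top hρfin hτρ
  have hτ0 : τ ≠ 0 := (lt_of_lt_of_le one_pos hτ).ne'
  have hρ0 : ρ ≠ 0 := (lt_of_lt_of_le one_pos (hτ.trans hτρ)).ne'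
  have hτp : 0 < τ.toReal := ENNReal.toReal_pos hτ0 hτfin
  have hρp : 0 < ρ.toReal := ENNReal.toReal_pos hρ0 hρfin
  have hn : ∀ i, (‖c i‖₊ : ℝ≥0∞) = ‖a i‖₊ * ‖b i‖₊ := by
    intro i
    rw [hc, nnnorm_mul, ENNReal.coe_mul]
  by_cases h' : ρ' = ∞
  · subst h'
    have : ρ = τ := by simpa using hconj
    subst this
    have hb : ∀ k : K, (‖b k‖₊ : ℝ≥0∞) ≤ lpNorm ∞ K b := by
      intro k
      rw [lpNorm, if_pos rfl]
      exact le_iSup₂_of_le k.1 k.2 le_rfl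
    generalize lpNorm ∞ K b = M at hb ⊢
    rw [← ENNReal.rpow_le_rpow_iff hρp, ENNReal.mul_rpow_of_nonneg _ _ hρp.le,
      lpNorm_rpow_aux _ hρfin hρ0, lpNorm_rpow_aux _ hρfin hρ0, ← ENNReal.tsum_mul_right]
    refine ENNReal.tsum_le_tsum fun k => ?_
    rw [hn, ENNReal.mul_rpow_of_nonneg _ _ hρp.le]
    gcongr
    exact hb k
  · have hρ'0 : ρ' ≠ 0 := by
      rintro rfl
      simp at hconj
      exact hτ0 (ENNReal.inv_eq_top.1 hconj.symm)
    have hρ'p : 0 < ρ'.toReal := ENNReal.toReal_pos hρ'0 h'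
    have hr : 1 / τ.toReal = 1 / ρ.toReal + 1 / ρ'.toReal := by
      have := congrArg ENNReal.toReal hconj
      rw [ENNReal.toReal_add (by simp [hρ0]) (by simp [hρ'0])] at this
      simpa using this.symm
    have hlt : τ.toReal < ρ.toReal := by
      have : 0 < 1 / ρ'.toReal := by positivity
      exact (one_div_lt_one_div hρp hτp).1 (by linarith)
    have := ENNReal.lintegral_Lp_mul_le_Lq_mul_Lr (α := K) hτp hlt hr
      (MeasureTheory.Measure.count) (f := fun k => (‖a k‖₊ : ℝ≥0∞))
      (g := fun k => (‖b k‖₊ : ℝ≥0∞)) (by fun_prop) (by fun_prop)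
    simp only [MeasureTheory.lintegral_count, Pi.mul_apply] at this
    simp only [lpNorm, if_neg h', if_neg hτfin, if_neg hρfin, hn]
    exact this

/-- Data-driven error bound for the pilot-sample algorithm: for `c` in the
pilot cone and `n ≥ n₁`, the approximation error satisfies
`‖(c_i)_{i≥n}‖_τ ≤ ERR(c,n)`. -/
theorem pilot_err_bound (τ ρ ρ' : ℝ≥0∞) (hτ : 1 ≤ τ) (hτρ : τ ≤ ρ)
    (hρfin : ρ ≠ ∞) (hconj : 1 / ρ + 1 / ρ' = 1 / τ)
    (lam : ℕ → ℝ) (hpos : ∀ i, 0 < lam i) (hanti : Antitone lam)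
    (hΛfin : lpNorm ρ' Set.univ lam ≠ ∞)
    (A : ℝ) (hA : 1 < A) (n₁ : ℕ) (c : ℕ → ℝ)
    (hcone : lpNorm ρ Set.univ (fun i => c i / lam i) ≤
      ENNReal.ofReal A * lpNorm ρ {i | i < n₁} (fun i => c i / lam i))
    (n : ℕ) (hn : n₁ ≤ n) :
    lpNorm τ {i | n ≤ i} c ≤ ERR ρ ρ' lam A n₁ n c := by
  have hρ0 : ρ ≠ 0 := (lt_of_lt_of_le one_pos (hτ.trans hτρ)).ne'
  have hρp : 0 < ρ.toReal := ENNReal.toReal_pos hρ0 hρfin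
  refine (lpNorm_holder_aux τ ρ ρ' hτ hτρ hρfin hconj _ (fun i => c i / lam i) lam c
    fun i => (div_mul_cancel₀ _ (hpos i).ne').symm).trans ?_
  unfold ERR
  gcongr
  rw [← ENNReal.rpow_le_rpow_iff hρp, ← ENNReal.rpow_mul, one_div, inv_mul_cancel₀ hρp.ne',
    ENNReal.rpow_one]
  have h1 := ENNReal.rpow_le_rpow hcone hρp.le
  rw [ENNReal.mul_rpow_of_nonneg _ _ hρp.le] at h1
  have hfin : lpNorm ρ {i | i < n} (fun i => c i / lam i) ^ ρ.toReal ≠ ∞ := by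
    rw [lpNorm_rpow_aux _ hρfin hρ0]
    have : Finite {i | i < n} := Set.finite_lt_nat n
    have := Fintype.ofFinite {i | i < n}
    rw [tsum_fintype]
    exact ENNReal.sum_ne_top.2 fun k _ => ENNReal.rpow_ne_top_of_nonneg hρp.le ENNReal.coe_ne_top
  refine ENNReal.le_sub_of_add_le_right hfin (le_trans (le_of_eq ?_) h1)
  simp only [lpNorm_rpow_aux _ hρfin hρ0]
  rw [← ENNReal.summable.tsum_union_disjoint (f := fun k => (‖c k / lam k‖₊ : ℝ≥0∞) ^ ρ.toReal)
    (s := {i | n ≤ i}) (t := {i | i < n}) _ ENNReal.summable]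
  · have : ({i | n ≤ i} ∪ {i | i < n} : Set ℕ) = Set.univ := by
      ext i
      simp [le_or_gt]
    rw [this]
  · exact Set.disjoint_left.2 fun i (h : n ≤ i) (h2 : i < n) => absurd h (not_le.2 h2)
end

section
/- Strong polynomial tractability criterion (case ρ' = ∞): Let (λ_{d,i})_{i∈ℕ}, for d ∈ ℕ, be a family of sequences of positive reals, each nonincreasing in i with λ_{d,i} → 0 as i → ∞. Define n(δ,d) := min{ n ∈ ℕ₀ : λ_{d,n+1} ≤ δ } for δ > 0. Then the following are equivalent: (a) there exist constants C, p > 0 such that n(δ,d) ≤ C δ^{−p} for all d ∈ ℕ and all δ ∈ (0,1]; (b) there exist η > 0 and i₀ ∈ ℕ such that sup_{d∈ℕ} Σ_{i=i₀}^∞ λ_{d,i}^η < ∞. Moreover, the infimum of the exponents p for which (a) holds equals the infimum of the η for which (b) holds. -/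
open scoped ENNReal NNReal

lemma spt_a_to_b (lam : ℕ → ℕ → ℝ)
    (hpos : ∀ d i, 0 < lam d i) (hanti : ∀ d, Antitone (lam d))
    (hlim : ∀ d, Filter.Tendsto (lam d) Filter.atTop (nhds 0))
    (C p η : ℝ) (hC : 0 < C) (hp : 0 < p) (hη : p < η)
    (h : ∀ d : ℕ, ∀ δ : ℝ, 0 < δ → δ ≤ 1 →
        ((sInf {n : ℕ | lam d n ≤ δ} : ℕ) : ℝ) ≤ C * δ ^ (-p)) :
    ∃ i₀ : ℕ, (⨆ d : ℕ, ∑' i : ℕ, ENNReal.ofReal (lam d (i₀ + i) ^ η)) < ⊤ := by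
  obtain ⟨k, hk⟩ := exists_nat_ge C
  have hη0 : 0 < η := hp.trans hη
  have key : ∀ d i : ℕ, C ≤ i → lam d i ^ η ≤ C ^ (η / p) * (1 / (i : ℝ) ^ (η / p)) := by
    intro d i hi
    have hi0 : (0 : ℝ) < i := hC.trans_le hi
    have hq : 0 < C / i := by positivity
    have hδ : 0 < (C / i) ^ (1 / p) := by positivity
    have hδ1 : (C / i) ^ (1 / p) ≤ 1 :=
      Real.rpow_le_one hq.le ((div_le_one hi0).2 hi) (by positivity)
    have h1 := h d _ hδ hδ1
    have h2 : C * ((C / i) ^ (1 / p)) ^ (-p) = i := by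
      rw [← Real.rpow_mul hq.le]
      have : 1 / p * -p = -1 := by field_simp
      rw [this, Real.rpow_neg_one]
      field_simp
    rw [h2] at h1
    have h3 : sInf {n : ℕ | lam d n ≤ (C / i) ^ (1 / p)} ≤ i := by exact_mod_cast h1
    have hne : {n : ℕ | lam d n ≤ (C / i) ^ (1 / p)}.Nonempty :=
      (((hlim d).eventually (gt_mem_nhds hδ)).exists).imp fun _ hn => le_of_lt hn
    have h4 : lam d i ≤ (C / i) ^ (1 / p) := (hanti d h3).trans (Nat.sInf_mem hne)
    calc lam d i ^ η ≤ ((C / i) ^ (1 / p)) ^ η :=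
          Real.rpow_le_rpow (hpos d i).le h4 hη0.le
      _ = (C / i) ^ (η / p) := by
          rw [← Real.rpow_mul hq.le]; congr 1; ring
      _ = _ := by rw [Real.div_rpow hC.le hi0.le]; ring
  have hs : Summable (fun i : ℕ => C ^ (η / p) * (1 / (i : ℝ) ^ (η / p))) :=
    (Real.summable_one_div_nat_rpow.2 ((one_lt_div hp).2 hη)).mul_left _
  have hs' : Summable (fun i : ℕ => C ^ (η / p) * (1 / ((k + i : ℕ) : ℝ) ^ (η / p))) :=
    hs.comp_injective (add_right_injective k)
  refine ⟨k, lt_of_le_of_lt (iSup_le fun d => ?_) hs'.tsum_ofReal_lt_top⟩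
  refine ENNReal.tsum_le_tsum fun i => ENNReal.ofReal_le_ofReal (key d (k + i) ?_)
  push_cast
  have : (0 : ℝ) ≤ i := by positivity
  linarith

lemma spt_b_to_a (lam : ℕ → ℕ → ℝ) (hpos : ∀ d i, 0 < lam d i)
    (η : ℝ) (hη : 0 < η) (i₀ : ℕ)
    (h : (⨆ d : ℕ, ∑' i : ℕ, ENNReal.ofReal (lam d (i₀ + i) ^ η)) < ⊤) :
    ∃ C > (0 : ℝ), ∀ d : ℕ, ∀ δ : ℝ, 0 < δ → δ ≤ 1 →
        ((sInf {n : ℕ | lam d n ≤ δ} : ℕ) : ℝ) ≤ C * δ ^ (-η) := by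
  set M := ⨆ d : ℕ, ∑' i : ℕ, ENNReal.ofReal (lam d (i₀ + i) ^ η) with hM
  have hM0 : 0 ≤ M.toReal := ENNReal.toReal_nonneg
  refine ⟨i₀ + M.toReal + 1, by positivity, fun d δ hδ hδ1 => ?_⟩
  set n := sInf {n : ℕ | lam d n ≤ δ} with hn
  have hlt : ∀ i < n, δ < lam d i := fun i hi => not_le.1 (Nat.notMem_of_lt_sInf hi)
  have hone : 1 ≤ δ ^ (-η) := Real.one_le_rpow_of_pos_of_le_one_of_nonpos hδ hδ1 (by linarith)
  have hb : ((n - i₀ : ℕ) : ℝ) * δ ^ η ≤ M.toReal := by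
    rw [← ENNReal.ofReal_le_iff_le_toReal h.ne]
    calc ENNReal.ofReal (((n - i₀ : ℕ) : ℝ) * δ ^ η)
        = ∑ _i ∈ Finset.range (n - i₀), ENNReal.ofReal (δ ^ η) := by
          rw [ENNReal.ofReal_mul (by positivity)]; simp
      _ ≤ ∑ i ∈ Finset.range (n - i₀), ENNReal.ofReal (lam d (i₀ + i) ^ η) := by
          refine Finset.sum_le_sum fun i hi => ENNReal.ofReal_le_ofReal ?_
          have := Finset.mem_range.1 hi
          exact Real.rpow_le_rpow hδ.le (hlt _ (by omega)).le hη.le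
      _ ≤ ∑' i : ℕ, ENNReal.ofReal (lam d (i₀ + i) ^ η) := ENNReal.sum_le_tsum _
      _ ≤ M := le_iSup (fun d => ∑' i : ℕ, ENNReal.ofReal (lam d (i₀ + i) ^ η)) d
  have hb2 : ((n - i₀ : ℕ) : ℝ) ≤ M.toReal * δ ^ (-η) := by
    rw [Real.rpow_neg hδ.le, ← div_eq_mul_inv, le_div_iff₀ (by positivity)]
    exact hb
  have hb3 : (n : ℝ) ≤ i₀ + ((n - i₀ : ℕ) : ℝ) := by
    have : n ≤ i₀ + (n - i₀) := by omega
    exact_mod_cast this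
  have hi : (i₀ : ℝ) ≤ i₀ * δ ^ (-η) := le_mul_of_one_le_right (by positivity) hone
  nlinarith

/-- Strong polynomial tractability criterion in the case `ρ' = ∞`.
Here `lam d i` is the `(i+1)`-st largest weight in dimension `d` (sequences
indexed from `0`), so the information cost at tolerance-to-radius ratio `δ` is
`n(δ,d) = sInf {n | lam d n ≤ δ}`.  Statement: `n(δ,d) ≤ C δ^{-p}` uniformly in
`d` for some `C, p > 0` iff `sup_d Σ_{i≥i₀} (lam d i)^η < ∞` for some `η > 0`
and `i₀`; and the infima of the admissible `p` and `η` agree. -/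
theorem spt_criterion_rho'_infinite (lam : ℕ → ℕ → ℝ)
    (hpos : ∀ d i, 0 < lam d i) (hanti : ∀ d, Antitone (lam d))
    (hlim : ∀ d, Filter.Tendsto (lam d) Filter.atTop (nhds 0)) :
    ((∃ C > (0 : ℝ), ∃ p > (0 : ℝ), ∀ d : ℕ, ∀ δ : ℝ, 0 < δ → δ ≤ 1 →
        ((sInf {n : ℕ | lam d n ≤ δ} : ℕ) : ℝ) ≤ C * δ ^ (-p)) ↔
      (∃ η > (0 : ℝ), ∃ i₀ : ℕ,
        (⨆ d : ℕ, ∑' i : ℕ, ENNReal.ofReal (lam d (i₀ + i) ^ η)) < ⊤)) ∧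
    sInf {p : ℝ | 0 < p ∧ ∃ C > (0 : ℝ), ∀ d : ℕ, ∀ δ : ℝ, 0 < δ → δ ≤ 1 →
        ((sInf {n : ℕ | lam d n ≤ δ} : ℕ) : ℝ) ≤ C * δ ^ (-p)} =
      sInf {η : ℝ | 0 < η ∧ ∃ i₀ : ℕ,
        (⨆ d : ℕ, ∑' i : ℕ, ENNReal.ofReal (lam d (i₀ + i) ^ η)) < ⊤} := by
  constructor
  · constructor
    · rintro ⟨C, hC, p, hp, h⟩
      exact ⟨p + 1, by linarith,
        spt_a_to_b lam hpos hanti hlim C p (p + 1) hC hp (by linarith) h⟩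
    · rintro ⟨η, hη, i₀, h⟩
      obtain ⟨C, hC, h'⟩ := spt_b_to_a lam hpos η hη i₀ h
      exact ⟨C, hC, η, hη, h'⟩
  · set A := {p : ℝ | 0 < p ∧ ∃ C > (0 : ℝ), ∀ d : ℕ, ∀ δ : ℝ, 0 < δ → δ ≤ 1 →
        ((sInf {n : ℕ | lam d n ≤ δ} : ℕ) : ℝ) ≤ C * δ ^ (-p)} with hA
    set B := {η : ℝ | 0 < η ∧ ∃ i₀ : ℕ,
        (⨆ d : ℕ, ∑' i : ℕ, ENNReal.ofReal (lam d (i₀ + i) ^ η)) < ⊤} with hB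
    have hBA : B ⊆ A := by
      rintro η ⟨hη, i₀, h⟩
      exact ⟨hη, spt_b_to_a lam hpos η hη i₀ h⟩
    have hAB : ∀ p ∈ A, ∀ η, p < η → η ∈ B := by
      rintro p ⟨hp, C, hC, h⟩ η hη
      exact ⟨hp.trans hη, spt_a_to_b lam hpos hanti hlim C p η hC hp hη h⟩
    have bA : BddBelow A := ⟨0, fun p hp => hp.1.le⟩
    have bB : BddBelow B := ⟨0, fun p hp => hp.1.le⟩
    rcases A.eq_empty_or_nonempty with hE | hne
    · have hBE : B = ∅ := Set.subset_eq_empty hBA hE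
      rw [hE, hBE]
    · have hneB : B.Nonempty := by
        obtain ⟨p, hp⟩ := hne
        exact ⟨p + 1, hAB p hp _ (by linarith)⟩
      refine le_antisymm (csInf_le_csInf bA hneB hBA) (le_csInf hne fun p hp => ?_)
      exact le_of_forall_gt_imp_ge_of_dense fun η hη => csInf_le bB (hAB p hp η hη)
end

section
/- Strong polynomial tractability criterion (case ρ' < ∞): Let 1 ≤ ρ' < ∞ and let (λ_{d,i})_{i∈ℕ}, for d ∈ ℕ, be a family of sequences of positive reals, each nonincreasing in i with Σ_{i=1}^∞ λ_{d,i}^{ρ'} < ∞. Define n(δ,d) := min{ n ∈ ℕ₀ : Σ_{i=n+1}^∞ λ_{d,i}^{ρ'} ≤ δ^{ρ'} } for δ > 0. Then the following are equivalent: (a) there exist constants C, p > 0 such that n(δ,d) ≤ C δ^{−p} for all d ∈ ℕ and all δ ∈ (0,1]; (b) there exist η ∈ (0,1) and i₀ ∈ ℕ such that sup_{d∈ℕ} Σ_{i=i₀}^∞ λ_{d,i}^{ρ' η} < ∞. Moreover, the infimum of the exponents p for which (a) holds equals inf{ ρ' η/(1−η) : η satisfies (b) }. -/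
open scoped ENNReal NNReal

lemma spt_aux_upper (ρ η M : ℝ) (hρ : 1 ≤ ρ) (h0 : 0 < η) (h1 : η < 1) (hM : 0 < M) (i₀ : ℕ)
    (a : ℕ → ℝ) (hpos : ∀ i, 0 < a i) (hanti : Antitone a)
    (hsum : Summable (fun i => a i ^ ρ))
    (hb : ∑' i : ℕ, ENNReal.ofReal (a (i₀ + i) ^ (ρ * η)) ≤ ENNReal.ofReal M)
    (δ : ℝ) (hδ : 0 < δ) (hδ1 : δ ≤ 1) :
    ((sInf {n : ℕ | (∑' i : ℕ, a (n + i) ^ ρ) ≤ δ ^ ρ} : ℕ) : ℝ) ≤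
      (i₀ + M ^ (1 / (1 - η))) * δ ^ (-(ρ * η / (1 - η))) := by
  have h1' : 0 < 1 - η := by linarith
  have hρ0 : 0 < ρ := by linarith
  set b : ℕ → ℝ := fun i => a (i₀ + i) ^ (ρ * η) with hbdef
  have hbpos : ∀ i, 0 < b i := fun i => Real.rpow_pos_of_pos (hpos _) _
  have hbs : Summable b := by
    have : Summable (fun i => (ENNReal.ofReal (b i)).toReal) :=
      ENNReal.summable_toReal (ne_top_of_le_ne_top ENNReal.ofReal_ne_top hb)
    refine this.congr (fun i => ?_)
    exact ENNReal.toReal_ofReal (hbpos i).le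
  have hbM : ∑' i, b i ≤ M := by
    rw [← ENNReal.ofReal_le_ofReal_iff hM.le,
      ENNReal.ofReal_tsum_of_nonneg (fun i => (hbpos i).le) hbs]
    exact hb
  have hbanti : Antitone b := fun i j hij =>
    Real.rpow_le_rpow (hpos _).le (hanti (by omega)) (by positivity)
  set X : ℝ := M ^ (1 / (1 - η)) * δ ^ (-(ρ * η / (1 - η))) with hX
  have hXpos : 0 < X := by positivity
  set m : ℕ := ⌊X⌋₊ with hm
  have hmX : X ≤ (m : ℝ) + 1 := (Nat.lt_floor_add_one X).le
  have hmX' : (m : ℝ) ≤ X := Nat.floor_le hXpos.le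
  have hbm : ((m : ℝ) + 1) * b m ≤ M := by
    have h : ∑ i ∈ Finset.range (m + 1), b m ≤ ∑ i ∈ Finset.range (m + 1), b i :=
      Finset.sum_le_sum (fun i hi => hbanti (by simp at hi; omega))
    have h' := hbs.sum_le_tsum (Finset.range (m + 1)) (fun i _ => (hbpos i).le)
    simp at h
    linarith
  have hbX : b m ≤ M / X := by
    rw [le_div_iff₀ hXpos]
    nlinarith [hbpos m]
  have hpow : (M / X) ^ ((1 - η) / η) = δ ^ ρ / M := by
    rw [hX, Real.div_rpow hM.le hXpos.le, Real.mul_rpow (by positivity) (by positivity),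
      ← Real.rpow_mul hM.le, ← Real.rpow_mul hδ.le]
    have e1 : 1 / (1 - η) * ((1 - η) / η) = (1 - η) / η + 1 := by field_simp; ring
    have e2 : -(ρ * η / (1 - η)) * ((1 - η) / η) = -ρ := by field_simp
    rw [e1, e2, Real.rpow_add hM, Real.rpow_one, Real.rpow_neg hδ.le]
    have := Real.rpow_pos_of_pos hM ((1 - η) / η)
    have := Real.rpow_pos_of_pos hδ ρ
    field_simp
  have hmem : i₀ + m ∈ {n : ℕ | (∑' i : ℕ, a (n + i) ^ ρ) ≤ δ ^ ρ} := by
    have hterm : ∀ i, a (i₀ + m + i) ^ ρ ≤ b (i + m) * (δ ^ ρ / M) := by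
      intro i
      have e : a (i₀ + m + i) ^ ρ = b (i + m) * b (i + m) ^ ((1 - η) / η) := by
        simp only [hbdef]
        rw [← Real.rpow_mul (hpos _).le, ← Real.rpow_add (hpos _)]
        congr 1
        · congr 1; omega
        · field_simp; ring
      rw [e, ← hpow]
      refine mul_le_mul_of_nonneg_left ?_ (hbpos _).le
      exact Real.rpow_le_rpow (hbpos _).le ((hbanti (by omega)).trans hbX) (by positivity)
    have hbs' : Summable (fun i => b (i + m)) := (summable_nat_add_iff m).2 hbs
    have hs2 : Summable (fun i => a (i₀ + m + i) ^ ρ) :=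
      Summable.of_nonneg_of_le (fun i => (Real.rpow_pos_of_pos (hpos _) _).le) hterm
        (hbs'.mul_right _)
    have h2 := hs2.tsum_le_tsum hterm (hbs'.mul_right _)
    rw [tsum_mul_right] at h2
    have h3 : ∑' i, b (i + m) ≤ M := by
      have := hbs.sum_add_tsum_nat_add m
      have h4 : 0 ≤ ∑ i ∈ Finset.range m, b i := Finset.sum_nonneg (fun i _ => (hbpos i).le)
      linarith
    refine h2.trans ((mul_le_mul_of_nonneg_right h3 (by positivity)).trans (le_of_eq ?_))
    field_simp
  have hle : ((sInf {n : ℕ | (∑' i : ℕ, a (n + i) ^ ρ) ≤ δ ^ ρ} : ℕ) : ℝ) ≤ ((i₀ + m : ℕ) : ℝ) :=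
    Nat.cast_le.2 (Nat.sInf_le hmem)
  have hone : 1 ≤ δ ^ (-(ρ * η / (1 - η))) :=
    Real.one_le_rpow_of_pos_of_le_one_of_nonpos hδ hδ1 (by
      have : 0 < ρ * η / (1 - η) := by positivity
      linarith)
  have hi : (i₀ : ℝ) ≤ i₀ * δ ^ (-(ρ * η / (1 - η))) :=
    le_mul_of_one_le_right (Nat.cast_nonneg _) hone
  push_cast at hle
  rw [add_mul]
  linarith

lemma spt_aux_tail (ρ C p : ℝ) (hρ : 1 ≤ ρ) (hC : 0 < C) (hp : 0 < p)
    (a : ℕ → ℝ) (hpos : ∀ i, 0 < a i) (hanti : Antitone a)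
    (hsum : Summable (fun i => a i ^ ρ))
    (h : ∀ δ : ℝ, 0 < δ → δ ≤ 1 →
      ((sInf {n : ℕ | (∑' i : ℕ, a (n + i) ^ ρ) ≤ δ ^ ρ} : ℕ) : ℝ) ≤ C * δ ^ (-p))
    (n : ℕ) (hn : C ≤ n) : a (2 * n) ^ ρ ≤ C ^ (ρ / p) * (n : ℝ) ^ (-(1 + ρ / p)) := by
  have hn0 : (0 : ℝ) < n := by linarith
  have hρ0 : 0 < ρ := by linarith
  set f : ℕ → ℝ := fun i => a i ^ ρ with hf
  have hfpos : ∀ i, 0 < f i := fun i => Real.rpow_pos_of_pos (hpos _) _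
  have hfanti : Antitone f := fun i j hij =>
    Real.rpow_le_rpow (hpos _).le (hanti hij) hρ0.le
  set δ : ℝ := (C / n) ^ (1 / p) with hδd
  have hCn : 0 < C / n := by positivity
  have hδ : 0 < δ := by positivity
  have hδ1 : δ ≤ 1 := Real.rpow_le_one hCn.le ((div_le_one hn0).2 hn) (by positivity)
  have hk := h δ hδ hδ1
  have e1 : C * δ ^ (-p) = n := by
    rw [hδd, ← Real.rpow_mul hCn.le]
    have : 1 / p * -p = -1 := by field_simp
    rw [this, Real.rpow_neg_one]
    field_simp
  rw [e1, Nat.cast_le] at hk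
  have hne : {n : ℕ | (∑' i : ℕ, a (n + i) ^ ρ) ≤ δ ^ ρ}.Nonempty := by
    have ht := tendsto_sum_nat_add f
    have hev := ht.eventually (gt_mem_nhds (Real.rpow_pos_of_pos hδ ρ))
    obtain ⟨N, hN⟩ := hev.exists
    refine ⟨N, ?_⟩
    have : ∑' i : ℕ, a (N + i) ^ ρ = ∑' i, f (i + N) :=
      tsum_congr (fun i => by simp only [hf]; rw [add_comm])
    simp only [Set.mem_setOf_eq]
    rw [this]
    exact hN.le
  have hmem := Nat.sInf_mem hne
  set k := sInf {n : ℕ | (∑' i : ℕ, a (n + i) ^ ρ) ≤ δ ^ ρ} with hkd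
  simp only [Set.mem_setOf_eq] at hmem
  have hsk : Summable (fun i => f (k + i)) := by
    have := (summable_nat_add_iff k).2 hsum
    exact this.congr (fun i => by simp only [hf]; rw [add_comm])
  have hfin : (n : ℝ) * f (2 * n) ≤ δ ^ ρ := by
    have h1 : ∑ i ∈ Finset.range n, f (2 * n) ≤ ∑ i ∈ Finset.range n, f (k + i) :=
      Finset.sum_le_sum (fun i hi => hfanti (by simp at hi; omega))
    have h2 := hsk.sum_le_tsum (Finset.range n) (fun i _ => (hfpos _).le)
    simp only [Finset.sum_const, Finset.card_range, nsmul_eq_mul] at h1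
    exact h1.trans (h2.trans hmem)
  have e2 : δ ^ ρ = C ^ (ρ / p) * (n : ℝ) ^ (-(ρ / p)) := by
    rw [hδd, ← Real.rpow_mul hCn.le, Real.div_rpow hC.le hn0.le, Real.rpow_neg hn0.le,
      div_eq_mul_inv]
    have : 1 / p * ρ = ρ / p := by ring
    rw [this]
  rw [e2] at hfin
  have e3 : (n : ℝ) ^ (-(1 + ρ / p)) = (n : ℝ) ^ (-(ρ / p)) / n := by
    rw [show -(1 + ρ / p) = -(ρ / p) - 1 by ring, Real.rpow_sub_one hn0.ne']
  rw [e3, ← mul_div_assoc, le_div_iff₀ hn0]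
  linarith

lemma spt_aux_lower (ρ C p p' : ℝ) (hρ : 1 ≤ ρ) (hC : 0 < C) (hp : 0 < p) (hpp : p < p')
    (lam : ℕ → ℕ → ℝ)
    (hpos : ∀ d i, 0 < lam d i) (hanti : ∀ d, Antitone (lam d))
    (hsum : ∀ d, Summable (fun i => lam d i ^ ρ))
    (h : ∀ d : ℕ, ∀ δ : ℝ, 0 < δ → δ ≤ 1 →
      ((sInf {n : ℕ | (∑' i : ℕ, lam d (n + i) ^ ρ) ≤ δ ^ ρ} : ℕ) : ℝ) ≤ C * δ ^ (-p)) :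
    ∃ η : ℝ, 0 < η ∧ η < 1 ∧ p' = ρ * η / (1 - η) ∧ ∃ i₀ : ℕ,
        (⨆ d : ℕ, ∑' i : ℕ, ENNReal.ofReal (lam d (i₀ + i) ^ (ρ * η))) < ⊤ := by
  have hρ0 : 0 < ρ := by linarith
  have hp' : 0 < p' := by linarith
  refine ⟨p' / (p' + ρ), by positivity, (div_lt_one (by positivity)).2 (by linarith), ?_,
    2 * (⌈C⌉₊ + 1), ?_⟩
  · have : 1 - p' / (p' + ρ) = ρ / (p' + ρ) := by field_simp; ring
    rw [this]
    field_simp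
  set η := p' / (p' + ρ) with hη
  have hη0 : 0 < η := by positivity
  set r := 1 + ρ / p with hr
  have hr0 : 0 < r := by positivity
  have hrη : 1 < r * η := by
    have : r * η = ((p + ρ) * p') / (p * (p' + ρ)) := by rw [hr, hη]; field_simp
    rw [this, one_lt_div (by positivity)]
    nlinarith
  set D := C ^ (ρ / p) * (2 : ℝ) ^ r with hD
  have hD0 : 0 < D := by positivity
  set g : ℕ → ℝ := fun i => D ^ η * ((i : ℝ) + 1) ^ (-(r * η)) with hg
  have hgs : Summable g := by
    have h1 : Summable (fun i : ℕ => (i : ℝ) ^ (-(r * η))) :=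
      Real.summable_nat_rpow.2 (by linarith)
    have h2 := (summable_nat_add_iff 1).2 h1
    refine (h2.mul_left (D ^ η)).congr (fun i => ?_)
    simp [hg]
  have hterm : ∀ d i, lam d (2 * (⌈C⌉₊ + 1) + i) ^ (ρ * η) ≤ g i := by
    intro d i
    obtain ⟨n, hnd⟩ : ∃ n, n = (2 * (⌈C⌉₊ + 1) + i) / 2 := ⟨_, rfl⟩
    have hn1 : ⌈C⌉₊ ≤ n := by omega
    have hn2 : i + 1 ≤ 2 * n := by omega
    have hn3 : 2 * n ≤ 2 * (⌈C⌉₊ + 1) + i := by omega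
    have hnC : C ≤ n := (Nat.le_ceil C).trans (by exact_mod_cast hn1)
    have hn2' : (i : ℝ) + 1 ≤ 2 * n := by exact_mod_cast hn2
    have hT := spt_aux_tail ρ C p hρ hC hp (lam d) (hpos d) (hanti d) (hsum d) (h d) n hnC
    have hi0 : (0 : ℝ) < (i : ℝ) + 1 := by positivity
    have h1 : (n : ℝ) ^ (-r) ≤ (2 : ℝ) ^ r * ((i : ℝ) + 1) ^ (-r) := by
      have : (n : ℝ) ^ (-r) ≤ (((i : ℝ) + 1) / 2) ^ (-r) :=
        Real.rpow_le_rpow_of_nonpos (by positivity) (by linarith) (by linarith)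
      refine this.trans (le_of_eq ?_)
      rw [Real.div_rpow hi0.le (by norm_num), Real.rpow_neg (by norm_num : (0 : ℝ) ≤ 2)]
      field_simp
    have h2 : lam d (2 * (⌈C⌉₊ + 1) + i) ^ ρ ≤ D * ((i : ℝ) + 1) ^ (-r) := by
      calc lam d (2 * (⌈C⌉₊ + 1) + i) ^ ρ ≤ lam d (2 * n) ^ ρ :=
            Real.rpow_le_rpow (hpos _ _).le (hanti d hn3) hρ0.le
        _ ≤ C ^ (ρ / p) * (n : ℝ) ^ (-r) := hT
        _ ≤ C ^ (ρ / p) * ((2 : ℝ) ^ r * ((i : ℝ) + 1) ^ (-r)) :=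
            mul_le_mul_of_nonneg_left h1 (by positivity)
        _ = D * ((i : ℝ) + 1) ^ (-r) := by rw [hD]; ring
    rw [Real.rpow_mul (hpos _ _).le]
    refine (Real.rpow_le_rpow (Real.rpow_pos_of_pos (hpos _ _) _).le h2 hη0.le).trans
      (le_of_eq ?_)
    rw [Real.mul_rpow hD0.le (by positivity), ← Real.rpow_mul hi0.le]
    simp only [hg]
    congr 2
    ring
  have hbd : (⨆ d : ℕ, ∑' i : ℕ, ENNReal.ofReal (lam d (2 * (⌈C⌉₊ + 1) + i) ^ (ρ * η))) ≤
      ∑' i, ENNReal.ofReal (g i) :=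
    iSup_le (fun d => ENNReal.tsum_le_tsum (fun i => ENNReal.ofReal_le_ofReal (hterm d i)))
  refine hbd.trans_lt ?_
  rw [← ENNReal.ofReal_tsum_of_nonneg (fun i => by simp only [hg]; positivity) hgs]
  exact ENNReal.ofReal_lt_top

lemma spt_aux_upper' (ρ η : ℝ) (hρ : 1 ≤ ρ) (h0 : 0 < η) (h1 : η < 1) (i₀ : ℕ)
    (lam : ℕ → ℕ → ℝ)
    (hpos : ∀ d i, 0 < lam d i) (hanti : ∀ d, Antitone (lam d))
    (hsum : ∀ d, Summable (fun i => lam d i ^ ρ))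
    (hb : (⨆ d : ℕ, ∑' i : ℕ, ENNReal.ofReal (lam d (i₀ + i) ^ (ρ * η))) < ⊤) :
    0 < ρ * η / (1 - η) ∧ ∃ C > (0 : ℝ), ∀ d : ℕ, ∀ δ : ℝ, 0 < δ → δ ≤ 1 →
      ((sInf {n : ℕ | (∑' i : ℕ, lam d (n + i) ^ ρ) ≤ δ ^ ρ} : ℕ) : ℝ) ≤
        C * δ ^ (-(ρ * η / (1 - η))) := by
  have h1' : 0 < 1 - η := by linarith
  set S := ⨆ d : ℕ, ∑' i : ℕ, ENNReal.ofReal (lam d (i₀ + i) ^ (ρ * η)) with hS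
  have hM : 0 < S.toReal + 1 := by positivity
  refine ⟨by positivity, i₀ + (S.toReal + 1) ^ (1 / (1 - η)), by positivity, ?_⟩
  intro d δ hδ hδ1
  refine spt_aux_upper ρ η (S.toReal + 1) hρ h0 h1 hM i₀ (lam d) (hpos d) (hanti d) (hsum d)
    ?_ δ hδ hδ1
  refine (le_iSup (fun d => ∑' i : ℕ, ENNReal.ofReal (lam d (i₀ + i) ^ (ρ * η))) d).trans ?_
  rw [← hS, ← ENNReal.ofReal_toReal hb.ne]
  apply ENNReal.ofReal_le_ofReal
  rw [ENNReal.toReal_ofReal ENNReal.toReal_nonneg]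
  linarith

/-- Strong polynomial tractability criterion in the case `ρ' < ∞`.
Here `lam d i` is the `(i+1)`-st largest weight in dimension `d` (sequences
indexed from `0`), so the information cost at tolerance-to-radius ratio `δ` is
`n(δ,d) = sInf {n | Σ_{i≥n} (lam d i)^{ρ'} ≤ δ^{ρ'}}`.  Statement:
`n(δ,d) ≤ C δ^{-p}` uniformly in `d` for some `C, p > 0` iff
`sup_d Σ_{i≥i₀} (lam d i)^{ρ'η} < ∞` for some `η ∈ (0,1)` and `i₀`; and the
infimum of the admissible `p` equals `inf {ρ'η/(1−η) : η admissible}`. -/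
theorem spt_criterion_rho'_finite (ρ' : ℝ) (hρ' : 1 ≤ ρ') (lam : ℕ → ℕ → ℝ)
    (hpos : ∀ d i, 0 < lam d i) (hanti : ∀ d, Antitone (lam d))
    (hsum : ∀ d, Summable (fun i => lam d i ^ ρ')) :
    ((∃ C > (0 : ℝ), ∃ p > (0 : ℝ), ∀ d : ℕ, ∀ δ : ℝ, 0 < δ → δ ≤ 1 →
        ((sInf {n : ℕ | (∑' i : ℕ, lam d (n + i) ^ ρ') ≤ δ ^ ρ'} : ℕ) : ℝ) ≤
          C * δ ^ (-p)) ↔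
      (∃ η : ℝ, 0 < η ∧ η < 1 ∧ ∃ i₀ : ℕ,
        (⨆ d : ℕ, ∑' i : ℕ, ENNReal.ofReal (lam d (i₀ + i) ^ (ρ' * η))) < ⊤)) ∧
    sInf {p : ℝ | 0 < p ∧ ∃ C > (0 : ℝ), ∀ d : ℕ, ∀ δ : ℝ, 0 < δ → δ ≤ 1 →
        ((sInf {n : ℕ | (∑' i : ℕ, lam d (n + i) ^ ρ') ≤ δ ^ ρ'} : ℕ) : ℝ) ≤
          C * δ ^ (-p)} =
      sInf {q : ℝ | ∃ η : ℝ, 0 < η ∧ η < 1 ∧ q = ρ' * η / (1 - η) ∧ ∃ i₀ : ℕ,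
        (⨆ d : ℕ, ∑' i : ℕ, ENNReal.ofReal (lam d (i₀ + i) ^ (ρ' * η))) < ⊤} := by
  constructor
  · constructor
    · rintro ⟨C, hC, p, hp, h⟩
      obtain ⟨η, h0, h1, -, hb⟩ := spt_aux_lower ρ' C p (p + 1) hρ' hC hp (by linarith) lam
        hpos hanti hsum h
      exact ⟨η, h0, h1, hb⟩
    · rintro ⟨η, h0, h1, i₀, hb⟩
      obtain ⟨hp, C, hC, h⟩ := spt_aux_upper' ρ' η hρ' h0 h1 i₀ lam hpos hanti hsum hb
      exact ⟨C, hC, _, hp, h⟩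
  · set P := {p : ℝ | 0 < p ∧ ∃ C > (0 : ℝ), ∀ d : ℕ, ∀ δ : ℝ, 0 < δ → δ ≤ 1 →
        ((sInf {n : ℕ | (∑' i : ℕ, lam d (n + i) ^ ρ') ≤ δ ^ ρ'} : ℕ) : ℝ) ≤
          C * δ ^ (-p)} with hP
    set Q := {q : ℝ | ∃ η : ℝ, 0 < η ∧ η < 1 ∧ q = ρ' * η / (1 - η) ∧ ∃ i₀ : ℕ,
        (⨆ d : ℕ, ∑' i : ℕ, ENNReal.ofReal (lam d (i₀ + i) ^ (ρ' * η))) < ⊤} with hQ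
    have hQP : Q ⊆ P := by
      rintro q ⟨η, h0, h1, rfl, i₀, hb⟩
      exact spt_aux_upper' ρ' η hρ' h0 h1 i₀ lam hpos hanti hsum hb
    have hPQ : ∀ p ∈ P, ∀ p' > p, p' ∈ Q := by
      rintro p ⟨hp, C, hC, h⟩ p' hpp
      exact spt_aux_lower ρ' C p p' hρ' hC hp hpp lam hpos hanti hsum h
    have hPb : BddBelow P := ⟨0, fun p hp => hp.1.le⟩
    rcases P.eq_empty_or_nonempty with hPe | ⟨p₀, hp₀⟩
    · have hQe : Q = ∅ := Set.subset_empty_iff.1 (hPe ▸ hQP)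
      rw [hPe, hQe]
    · have hQn : Q.Nonempty := ⟨p₀ + 1, hPQ p₀ hp₀ _ (by linarith)⟩
      apply le_antisymm
      · exact csInf_le_csInf hPb hQn hQP
      · refine le_csInf ⟨p₀, hp₀⟩ (fun p hp => ?_)
        refine le_of_forall_gt_imp_ge_of_dense (fun p' hpp => ?_)
        exact csInf_le (hPb.mono hQP) (hPQ p hp p' hpp)
end

section
/- Summability equivalence underlying the strong tractability corollary for product weights: Let (w_ℓ)_{ℓ∈ℕ} and (s_k)_{k∈ℕ} be positive reals and let η > 0. For each d ∈ ℕ and k ∈ ℕ₀^d define λ_{d,k} := Π_{ℓ ≤ d, k_ℓ>0} w_ℓ s_{k_ℓ}. Then sup_{d∈ℕ} Σ_{k ∈ ℕ₀^d} λ_{d,k}^η < ∞ if and only if both Σ_{k=1}^∞ s_k^η < ∞ and Σ_{ℓ=1}^∞ w_ℓ^η < ∞. -/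
open scoped ENNReal NNReal

theorem pw_tsum_pi (d : ℕ) (f : Fin d → ℕ → ℝ≥0∞) :
    ∑' k : Fin d → ℕ, ∏ i, f i (k i) = ∏ i, ∑' n, f i n := by
  induction d with
  | zero => simp [tsum_fintype]
  | succ d ih =>
    rw [← (Fin.consEquiv (fun _ : Fin (d+1) => ℕ)).tsum_eq, ENNReal.tsum_prod']
    simp only [Fin.consEquiv_apply, Fin.prod_univ_succ, Fin.cons_zero, Fin.cons_succ]
    simp_rw [ENNReal.tsum_mul_left, ENNReal.tsum_mul_right]
    rw [ih (fun i => f i.succ)]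

theorem pw_sum_le_prod (a : ℕ → ℝ≥0∞) (d : ℕ) :
    1 + ∑ i ∈ Finset.range d, a i ≤ ∏ i ∈ Finset.range d, (1 + a i) := by
  induction d with
  | zero => simp
  | succ d ih =>
    rw [Finset.sum_range_succ, Finset.prod_range_succ, mul_add, mul_one, ← add_assoc]
    refine add_le_add ih ?_
    calc a d = 1 * a d := (one_mul _).symm
      _ ≤ _ := by
        gcongr
        exact le_trans le_self_add ih

theorem pw_summable_iff (a : ℕ → ℝ) (ha : ∀ i, 0 ≤ a i) :
    Summable a ↔ ∑' i, ENNReal.ofReal (a i) ≠ ⊤ := by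
  constructor
  · exact fun h => h.tsum_ofReal_ne_top
  · intro h
    have := ENNReal.summable_toReal h
    simpa [ENNReal.toReal_ofReal, ha] using this

theorem pw_key (w : ℕ → ℝ) (s : ℕ → ℝ)
    (hw : ∀ ℓ, 0 < w ℓ) (hs : ∀ k, 0 < s k) (η : ℝ) (d : ℕ) :
    (∑' k : Fin d → ℕ,
        ENNReal.ofReal
          ((∏ ℓ : Fin d, if k ℓ = 0 then 1 else w ℓ.val * s (k ℓ)) ^ η)) =
    ∏ i ∈ Finset.range d,
      (1 + ENNReal.ofReal (w i ^ η) * ∑' n, ENNReal.ofReal (s (n + 1) ^ η)) := by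
  have hpos : ∀ (l n : ℕ), 0 ≤ (if n = 0 then (1:ℝ) else w l * s n) := by
    intro l n
    split_ifs
    · exact zero_le_one
    · exact (mul_pos (hw _) (hs _)).le
  have h1 : ∀ k : Fin d → ℕ, ENNReal.ofReal
      ((∏ ℓ : Fin d, if k ℓ = 0 then 1 else w ℓ.val * s (k ℓ)) ^ η) =
      ∏ ℓ : Fin d, ENNReal.ofReal ((if k ℓ = 0 then 1 else w ℓ.val * s (k ℓ)) ^ η) := by
    intro k
    rw [← Real.finsetProd_rpow _ _ (fun (i : Fin d) _ => hpos i.val (k i)),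
      ENNReal.ofReal_prod_of_nonneg (fun (i : Fin d) _ => Real.rpow_nonneg (hpos i.val (k i)) η)]
  simp_rw [h1]
  rw [pw_tsum_pi d (fun ℓ n => ENNReal.ofReal ((if n = 0 then 1 else w ℓ.val * s n) ^ η)),
    ← Fin.prod_univ_eq_prod_range
      (fun i => 1 + ENNReal.ofReal (w i ^ η) * ∑' n, ENNReal.ofReal (s (n + 1) ^ η)) d]
  refine Finset.prod_congr rfl fun i _ => ?_
  rw [tsum_eq_zero_add' ENNReal.summable, ← ENNReal.tsum_mul_left]
  congr 1
  · simp
  · refine tsum_congr fun n => ?_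
    rw [if_neg (Nat.succ_ne_zero n), Real.mul_rpow (hw _).le (hs _).le,
      ENNReal.ofReal_mul (Real.rpow_nonneg (hw _).le _)]

/-- Summability equivalence for strong tractability with product weights:
for product weights `λ_{d,k} = Π_{ℓ ≤ d, k_ℓ > 0} w_ℓ s_{k_ℓ}` on `ℕ₀^d`
(here `k : Fin d → ℕ`, coordinate weights `w 0, w 1, …`, smoothness weights
`s 1, s 2, …`), one has
`sup_{d} Σ_{k ∈ ℕ₀^d} λ_{d,k}^η < ∞` iff both `Σ_{k≥1} s_k^η < ∞` and
`Σ_ℓ w_ℓ^η < ∞`. -/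
theorem product_weight_summability_equivalence (w : ℕ → ℝ) (s : ℕ → ℝ)
    (hw : ∀ ℓ, 0 < w ℓ) (hs : ∀ k, 0 < s k) (η : ℝ) (hη : 0 < η) :
    (⨆ d : ℕ, ∑' k : Fin d → ℕ,
        ENNReal.ofReal
          ((∏ ℓ : Fin d, if k ℓ = 0 then 1 else w ℓ.val * s (k ℓ)) ^ η)) < ⊤ ↔
      Summable (fun k : ℕ => s (k + 1) ^ η) ∧
        Summable (fun ℓ : ℕ => w ℓ ^ η) := by
  have hw' : ∀ i, 0 < w i ^ η := fun i => Real.rpow_pos_of_pos (hw i) η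
  have hs' : ∀ i, 0 < s (i + 1) ^ η := fun i => Real.rpow_pos_of_pos (hs _) η
  simp_rw [pw_key w s hw hs η]
  constructor
  · intro h
    have hb := fun d => le_iSup (fun d => ∏ i ∈ Finset.range d,
      (1 + ENNReal.ofReal (w i ^ η) * ∑' n, ENNReal.ofReal (s (n + 1) ^ η))) d
    have hS : ∑' n, ENNReal.ofReal (s (n + 1) ^ η) ≠ ⊤ := by
      intro hT
      have h1 := (hb 1).trans_lt h
      rw [Finset.prod_range_one, hT,
        ENNReal.mul_top (ENNReal.ofReal_pos.2 (hw' 0)).ne'] at h1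
      simp at h1
    have hS0 : ∑' n, ENNReal.ofReal (s (n + 1) ^ η) ≠ 0 := by
      intro h0
      have := ENNReal.tsum_eq_zero.1 h0 0
      exact (ENNReal.ofReal_pos.2 (hs' 0)).ne' this
    refine ⟨(pw_summable_iff _ fun i => (hs' i).le).2 hS,
      (pw_summable_iff _ fun i => (hw' i).le).2 fun hT => ?_⟩
    have h2 : ∑' i, ENNReal.ofReal (w i ^ η) * ∑' n, ENNReal.ofReal (s (n + 1) ^ η) < ⊤ := by
      refine lt_of_le_of_lt ?_ h
      rw [ENNReal.tsum_eq_iSup_nat]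
      exact iSup_le fun d => (le_add_self.trans (pw_sum_le_prod _ d)).trans (hb d)
    rw [ENNReal.tsum_mul_right, hT, ENNReal.top_mul hS0] at h2
    exact lt_irrefl _ h2
  · rintro ⟨h1, h2⟩
    rw [← ENNReal.ofReal_tsum_of_nonneg (fun i => (hs' i).le) h1]
    have hT : 0 ≤ ∑' n, s (n + 1) ^ η := tsum_nonneg fun i => (hs' i).le
    set T := ∑' n, s (n + 1) ^ η
    refine lt_of_le_of_lt (iSup_le fun d => ?_)
      (ENNReal.ofReal_lt_top (r := Real.exp (∑' i, w i ^ η * T)))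
    have hn : ∀ i, 0 ≤ w i ^ η * T := fun i => mul_nonneg (hw' i).le hT
    have h3 : ∀ i, 1 + ENNReal.ofReal (w i ^ η) * ENNReal.ofReal T =
        ENNReal.ofReal (1 + w i ^ η * T) := by
      intro i
      rw [ENNReal.ofReal_add zero_le_one (hn i), ENNReal.ofReal_mul (hw' i).le,
        ENNReal.ofReal_one]
    simp_rw [h3]
    rw [← ENNReal.ofReal_prod_of_nonneg (fun i _ => add_nonneg zero_le_one (hn i))]
    apply ENNReal.ofReal_le_ofReal
    calc _ ≤ ∏ i ∈ Finset.range d, Real.exp (w i ^ η * T) :=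
          Finset.prod_le_prod (fun i _ => add_nonneg zero_le_one (hn i))
            (fun i _ => by rw [add_comm]; exact Real.add_one_le_exp _)
      _ = Real.exp (∑ i ∈ Finset.range d, w i ^ η * T) := (Real.exp_sum _ _).symm
      _ ≤ _ := Real.exp_le_exp.2 ((h2.mul_right T).sum_le_tsum _ (fun i _ => hn i))
end

section
/- Complexity bound for the Chebyshev example: Let d ∈ ℕ, r > 0, and let w_1, w_2, … be nonnegative reals. For k ∈ ℕ₀^d define λ_k := Π_{ℓ ≤ d, k_ℓ>0} w_ℓ k_ℓ^{−r}, and let (λ_{k_i})_{i∈ℕ} be a nonincreasing enumeration of (λ_k)_{k∈ℕ₀^d}. Then for every p > 1/r and every n ∈ ℕ₀, (n+1) λ_{k_{n+1}}^p ≤ Π_{ℓ=1}^d (1 + w_ℓ^p ζ(pr)) ≤ exp( ζ(pr) Σ_{ℓ=1}^∞ w_ℓ^p ), where ζ is the Riemann zeta function; consequently, for all R ≥ ε > 0, min{ n ∈ ℕ₀ : λ_{k_{n+1}} ≤ ε/R } ≤ ⌈ (R/ε)^p exp( ζ(pr) Σ_{ℓ=1}^∞ w_ℓ^p ) ⌉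 − 1. -/
open scoped ENNReal NNReal

/-- Complexity bound for the Chebyshev example: with weights
`λ_k = Π_{ℓ ≤ d, k_ℓ > 0} w_ℓ k_ℓ^{-r}` on `ℕ₀^d` (here `k : Fin d → ℕ`) and a
nonincreasing enumeration `e : ℕ ≃ (Fin d → ℕ)` of the weights, for every
`p > 1/r`:
`(n+1) λ_{e n}^p ≤ Π_{ℓ=1}^d (1 + w_ℓ^p ζ(pr)) ≤ exp(ζ(pr) Σ_{ℓ=1}^∞ w_ℓ^p)`
(with `ζ(x) = Σ_{k=1}^∞ k^{-x}`), and consequently for all `R ≥ ε > 0`,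
`min{n : λ_{e n} ≤ ε/R} ≤ ⌈(R/ε)^p exp(ζ(pr) Σ_ℓ w_ℓ^p)⌉ − 1`.
(Enumeration indexed from `0`, so `e n` is the `(n+1)`-st wavenumber.) -/
theorem chebyshev_complexity_bound (d : ℕ) (r : ℝ) (hr : 0 < r)
    (w : ℕ → ℝ) (hw : ∀ ℓ, 0 ≤ w ℓ)
    (Λ : (Fin d → ℕ) → ℝ)
    (hΛ : ∀ k, Λ k = ∏ ℓ : Fin d, if k ℓ = 0 then 1 else w ℓ.val * (k ℓ : ℝ) ^ (-r))
    (e : ℕ ≃ (Fin d → ℕ)) (hanti : Antitone (fun i => Λ (e i)))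
    (p : ℝ) (hp : 1 / r < p)
    (hsum : Summable (fun ℓ : ℕ => w ℓ ^ p)) :
    (∀ n : ℕ,
      ((n : ℝ) + 1) * Λ (e n) ^ p ≤
        ∏ ℓ : Fin d, (1 + w ℓ.val ^ p * ∑' k : ℕ, ((k : ℝ) + 1) ^ (-(p * r))) ∧
      (∏ ℓ : Fin d, (1 + w ℓ.val ^ p * ∑' k : ℕ, ((k : ℝ) + 1) ^ (-(p * r)))) ≤
        Real.exp ((∑' k : ℕ, ((k : ℝ) + 1) ^ (-(p * r))) * ∑' ℓ : ℕ, w ℓ ^ p)) ∧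
    ∀ R ε : ℝ, 0 < ε → ε ≤ R →
      sInf {n : ℕ | Λ (e n) ≤ ε / R} ≤
        ⌈(R / ε) ^ p *
          Real.exp ((∑' k : ℕ, ((k : ℝ) + 1) ^ (-(p * r))) * ∑' ℓ : ℕ, w ℓ ^ p)⌉₊
          - 1 := by
  have hp0 : 0 < p := lt_trans (by positivity) hp
  have hpr : 1 < p * r := by rwa [div_lt_iff₀ hr] at hp
  have hz : Summable (fun k : ℕ => ((k : ℝ) + 1) ^ (-(p * r))) := by
    have h := (Real.summable_nat_rpow (p := -(p * r))).2 (by linarith)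
    have h2 := (summable_nat_add_iff 1).2 h
    simpa using h2
  have hz0 : 0 ≤ ∑' k : ℕ, ((k : ℝ) + 1) ^ (-(p * r)) :=
    tsum_nonneg fun k => by positivity
  have hf0 : ∀ (ℓ : Fin d) (j : ℕ),
      0 ≤ (if j = 0 then (1 : ℝ) else w ℓ.val * (j : ℝ) ^ (-r)) := by
    intro ℓ j
    have := hw ℓ.val
    split_ifs <;> positivity
  have hΛ0 : ∀ k, 0 ≤ Λ k := by
    intro k
    rw [hΛ]
    exact Finset.prod_nonneg fun ℓ _ => hf0 ℓ (k ℓ)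
  have hΛp : ∀ k, Λ k ^ p =
      ∏ ℓ : Fin d, (if k ℓ = 0 then (1 : ℝ) else w ℓ.val * (k ℓ : ℝ) ^ (-r)) ^ p := by
    intro k
    rw [hΛ, Real.finsetProd_rpow _ _ fun ℓ _ => hf0 ℓ (k ℓ)]
  have h1 : ∀ n : ℕ, ((n : ℝ) + 1) * Λ (e n) ^ p ≤
        ∏ ℓ : Fin d, (1 + w ℓ.val ^ p * ∑' k : ℕ, ((k : ℝ) + 1) ^ (-(p * r))) := by
    intro n
    have a1 : ((n : ℝ) + 1) * Λ (e n) ^ p ≤ ∑ i ∈ Finset.range (n + 1), Λ (e i) ^ p := by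
      have := Finset.card_nsmul_le_sum (Finset.range (n + 1)) (fun i => Λ (e i) ^ p)
        (Λ (e n) ^ p) (fun i hi => Real.rpow_le_rpow (hΛ0 _)
          (hanti (Nat.lt_succ_iff.1 (Finset.mem_range.1 hi))) hp0.le)
      simpa using this
    obtain ⟨N, hN⟩ : ∃ N : ℕ, ∀ i ∈ Finset.range (n + 1), ∀ ℓ, e i ℓ ≤ N := by
      refine ⟨∑ i ∈ Finset.range (n + 1), ∑ ℓ, e i ℓ, fun i hi ℓ => ?_⟩
      exact (Finset.single_le_sum (f := fun ℓ => e i ℓ) (fun _ _ => Nat.zero_le _)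
        (Finset.mem_univ ℓ)).trans
        (Finset.single_le_sum (f := fun i => ∑ ℓ, e i ℓ) (fun _ _ => Nat.zero_le _) hi)
    have a2 : ∑ i ∈ Finset.range (n + 1), Λ (e i) ^ p ≤
        ∑ k ∈ Fintype.piFinset (fun _ : Fin d => Finset.range (N + 1)), Λ k ^ p := by
      refine (Finset.sum_map (Finset.range (n + 1)) e.toEmbedding (fun k => Λ k ^ p)).symm.le.trans ?_
      apply Finset.sum_le_sum_of_subset_of_nonneg
      · intro k hk
        obtain ⟨i, hi, rfl⟩ := Finset.mem_map.1 hk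
        rw [Fintype.mem_piFinset]
        intro ℓ
        exact Finset.mem_range.2 (Nat.lt_succ_of_le (hN i hi ℓ))
      · intro k _ _
        exact Real.rpow_nonneg (hΛ0 k) p
    refine a1.trans (a2.trans ?_)
    simp only [hΛp]
    rw [← Finset.prod_univ_sum (fun _ : Fin d => Finset.range (N + 1))
      (fun ℓ j => (if j = 0 then (1 : ℝ) else w ℓ.val * (j : ℝ) ^ (-r)) ^ p)]
    apply Finset.prod_le_prod
    · intro ℓ _
      exact Finset.sum_nonneg fun j _ => Real.rpow_nonneg (hf0 ℓ j) p
    · intro ℓ _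
      rw [Finset.sum_range_succ']
      have a3 : ∀ j : ℕ, (if j + 1 = 0 then (1 : ℝ)
          else w ℓ.val * ((j + 1 : ℕ) : ℝ) ^ (-r)) ^ p =
          w ℓ.val ^ p * ((j : ℝ) + 1) ^ (-(p * r)) := by
        intro j
        rw [if_neg (Nat.succ_ne_zero j), Real.mul_rpow (hw _) (by positivity),
          ← Real.rpow_mul (by positivity)]
        push_cast
        congr 2
        ring
      simp only [a3]
      rw [← Finset.mul_sum, if_pos trivial, Real.one_rpow, add_comm]
      have a4 := hz.sum_le_tsum (Finset.range N) (fun k _ => by positivity)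
      have a5 : 0 ≤ w ℓ.val ^ p := Real.rpow_nonneg (hw _) p
      gcongr
  have h2 : (∏ ℓ : Fin d, (1 + w ℓ.val ^ p * ∑' k : ℕ, ((k : ℝ) + 1) ^ (-(p * r)))) ≤
        Real.exp ((∑' k : ℕ, ((k : ℝ) + 1) ^ (-(p * r))) * ∑' ℓ : ℕ, w ℓ ^ p) := by
    set Z := ∑' k : ℕ, ((k : ℝ) + 1) ^ (-(p * r))
    have b1 : (∏ ℓ : Fin d, (1 + w ℓ.val ^ p * Z)) ≤
        ∏ ℓ : Fin d, Real.exp (w ℓ.val ^ p * Z) := by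
      apply Finset.prod_le_prod
      · intro ℓ _
        have a5 : 0 ≤ w ℓ.val ^ p := Real.rpow_nonneg (hw _) p
        positivity
      · intro ℓ _
        rw [add_comm]
        exact Real.add_one_le_exp _
    refine b1.trans ?_
    rw [← Real.exp_sum, ← Finset.sum_mul, mul_comm]
    apply Real.exp_le_exp.2
    apply mul_le_mul_of_nonneg_left _ hz0
    rw [Fin.sum_univ_eq_sum_range (fun i => w i ^ p) d]
    exact hsum.sum_le_tsum _ (fun k _ => Real.rpow_nonneg (hw _) p)
  refine ⟨fun n => ⟨h1 n, h2⟩, ?_⟩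
  intro R ε hε hR
  have hR0 : 0 < R := hε.trans_le hR
  apply Nat.sInf_le
  have h3 := fun n => (h1 n).trans h2
  set E := Real.exp ((∑' k : ℕ, ((k : ℝ) + 1) ^ (-(p * r))) * ∑' ℓ : ℕ, w ℓ ^ p) with hE
  have hE0 : 0 < E := Real.exp_pos _
  have hq : 0 < (R / ε) ^ p := by positivity
  have hB : 0 < (R / ε) ^ p * E := by positivity
  have hc := Nat.le_ceil ((R / ε) ^ p * E)
  have hc0 := Nat.ceil_pos.2 hB
  obtain ⟨m, hm⟩ := Nat.exists_eq_succ_of_ne_zero hc0.ne'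
  rw [hm] at hc ⊢
  have h4 := h3 m
  simp only [Nat.succ_eq_add_one, Nat.add_sub_cancel, Set.mem_ofPred_eq]
  push_cast at hc
  have hx0 : 0 ≤ Λ (e m) ^ p := Real.rpow_nonneg (hΛ0 _) p
  have h5 : (R / ε) ^ p * Λ (e m) ^ p ≤ 1 := by
    have h6 : ((R / ε) ^ p * E) * Λ (e m) ^ p ≤ E :=
      (mul_le_mul_of_nonneg_right hc hx0).trans h4
    have h7 : E * ((R / ε) ^ p * Λ (e m) ^ p) ≤ E * 1 := by linarith
    exact le_of_mul_le_mul_left h7 hE0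
  rw [← Real.mul_rpow (by positivity) (hΛ0 _)] at h5
  have h8 : R / ε * Λ (e m) ≤ 1 := by
    by_contra hcon
    exact absurd h5 (not_le.2 (Real.one_lt_rpow (not_le.1 hcon) hp0))
  rw [le_div_iff₀ hR0]
  rw [div_mul_eq_mul_div, div_le_one hε] at h8
  linarith
end

section
/- Data-driven error bound for the decay-tracking algorithm: Let 1 ≤ τ ≤ ρ < ∞ with 1/ρ + 1/ρ' = 1/τ, let 0 < b < 1 < a, let λ = (λ_i)_{i∈ℕ} be positive with ‖λ‖_{ρ'} < ∞, and let 0 = n₀ < n₁ < n₂ < ⋯ be strictly increasing integers. For a real sequence c, define σ_j(c) := ‖(c_i/λ_i)_{i=n_{j−1}+1}^{n_j}‖_ρ and Λ_j := ‖(λ_i)_{i=n_{j−1}+1}^{n_j}‖_{ρ'}. If c lies in the decay-tracking cone, i.e., σ_{j+r}(c) ≤ a b^r σ_j(c) for all j, r ∈ ℕ, then for every j ∈ ℕ, ‖(c_i)_{i>n_j}‖_τ ≤ a σ_j(c) · ‖( b^r Λ_{j+r} )_{r=1}^∞‖_τ. -/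
open scoped ENNReal NNReal

/-- `σ_j(c)`: the `ρ`-norm of the normalized coefficients `c_i/λ_i` over the
`j`-th block `K_j = {i | n_{j-1} ≤ i < n_j}` (sequences indexed from `0`). -/
noncomputable def blockSigma (ρ : ℝ≥0∞) (lam : ℕ → ℝ) (n : ℕ → ℕ) (c : ℕ → ℝ)
    (j : ℕ) : ℝ≥0∞ :=
  lpNorm ρ {i | n (j - 1) ≤ i ∧ i < n j} (fun i => c i / lam i)

/-- `Λ_j`: the `ρ'`-norm of the weights over the `j`-th block. -/
noncomputable def blockLam (ρ' : ℝ≥0∞) (lam : ℕ → ℝ) (n : ℕ → ℕ)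
    (j : ℕ) : ℝ≥0∞ :=
  lpNorm ρ' {i | n (j - 1) ≤ i ∧ i < n j} lam

theorem lpNorm_rpow {p : ℝ≥0∞} (hp0 : p ≠ 0) (hp : p ≠ ∞) (K : Set ℕ) (a : ℕ → ℝ) :
    lpNorm p K a = (∑' k : K, (‖a k‖₊ : ℝ≥0∞) ^ p.toReal) ^ (1 / p.toReal) := by
  simp [lpNorm, hp]

theorem block_holder (τ ρ ρ' : ℝ≥0∞) (hτ : 1 ≤ τ) (hτρ : τ ≤ ρ)
    (hρfin : ρ ≠ ∞) (hconj : 1 / ρ + 1 / ρ' = 1 / τ)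
    (lam c : ℕ → ℝ) (hpos : ∀ i, 0 < lam i) (s : Finset ℕ) :
    ∑ k ∈ s, (‖c k‖₊ : ℝ≥0∞) ^ τ.toReal ≤
      (lpNorm ρ (s : Set ℕ) (fun i => c i / lam i) * lpNorm ρ' (s : Set ℕ) lam) ^ τ.toReal := by
  have hτfin : τ ≠ ∞ := ne_top_of_le_ne_top hρfin hτρ
  have hτ0 : τ ≠ 0 := (zero_lt_one.trans_le hτ).ne'
  have hρ0 : ρ ≠ 0 := (zero_lt_one.trans_le (hτ.trans hτρ)).ne'
  have ht : 0 < τ.toReal := ENNReal.toReal_pos hτ0 hτfin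
  have hr : 0 < ρ.toReal := ENNReal.toReal_pos hρ0 hρfin
  have hfac : ∀ k, (‖c k‖₊ : ℝ≥0∞) ^ τ.toReal =
      (‖c k / lam k‖₊ : ℝ≥0∞) ^ τ.toReal * (‖lam k‖₊ : ℝ≥0∞) ^ τ.toReal := by
    intro k
    rw [← ENNReal.mul_rpow_of_nonneg _ _ ht.le, ← ENNReal.coe_mul, ← nnnorm_mul,
      div_mul_cancel₀ _ (hpos k).ne']
  rw [lpNorm_rpow hρ0 hρfin, ENNReal.mul_rpow_of_nonneg _ _ ht.le,
    Finset.tsum_subtype' s (fun k => (‖c k / lam k‖₊ : ℝ≥0∞) ^ ρ.toReal), ← ENNReal.rpow_mul]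
  simp_rw [hfac]
  by_cases hρ' : ρ' = ∞
  · have hEq : ρ = τ := by
      subst hρ'
      simpa using hconj
    subst hEq
    rw [one_div_mul_cancel hr.ne', ENNReal.rpow_one, Finset.sum_mul]
    refine Finset.sum_le_sum fun k hk => ?_
    gcongr
    rw [lpNorm, if_pos hρ']
    exact le_iSup₂ (f := fun k (_ : k ∈ (s : Set ℕ)) => (‖lam k‖₊ : ℝ≥0∞)) k hk
  · have hρ'0 : ρ' ≠ 0 := by
      rintro rfl
      simp at hconj
      exact hτ0 (ENNReal.inv_eq_top.mp hconj.symm)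
    have hr' : 0 < ρ'.toReal := ENNReal.toReal_pos hρ'0 hρ'
    have hreal : 1 / ρ.toReal + 1 / ρ'.toReal = 1 / τ.toReal := by
      have := congrArg ENNReal.toReal hconj
      rw [ENNReal.toReal_add (by simp [hρ0]) (by simp [hρ'0])] at this
      simpa using this
    have hc : (ρ.toReal / τ.toReal).HolderConjugate (ρ'.toReal / τ.toReal) := by
      refine ⟨?_, by positivity, by positivity⟩
      field_simp at hreal ⊢
      linarith
    rw [lpNorm_rpow hρ'0 hρ',
      Finset.tsum_subtype' s (fun k => (‖lam k‖₊ : ℝ≥0∞) ^ ρ'.toReal), ← ENNReal.rpow_mul]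
    have := ENNReal.inner_le_Lp_mul_Lq s (fun k => (‖c k / lam k‖₊ : ℝ≥0∞) ^ τ.toReal)
      (fun k => (‖lam k‖₊ : ℝ≥0∞) ^ τ.toReal) hc
    simp_rw [← ENNReal.rpow_mul, mul_div_cancel₀ _ ht.ne'] at this
    convert this using 3 <;> field_simp

/-- Data-driven error bound for the decay-tracking algorithm: if `c` lies in
the decay-tracking cone, i.e., `σ_{j+r}(c) ≤ a b^r σ_j(c)` for all `j, r ≥ 1`,
then for every `j ≥ 1`,
`‖(c_i)_{i ≥ n_j}‖_τ ≤ a σ_j(c) ‖(b^r Λ_{j+r})_{r=1}^∞‖_τ`. -/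
theorem decay_tracking_error_bound (τ ρ ρ' : ℝ≥0∞) (hτ : 1 ≤ τ) (hτρ : τ ≤ ρ)
    (hρfin : ρ ≠ ∞) (hconj : 1 / ρ + 1 / ρ' = 1 / τ)
    (a b : ℝ) (hb0 : 0 < b) (hb1 : b < 1) (ha : 1 < a)
    (lam : ℕ → ℝ) (hpos : ∀ i, 0 < lam i)
    (hΛfin : lpNorm ρ' Set.univ lam ≠ ∞)
    (n : ℕ → ℕ) (hn0 : n 0 = 0) (hmono : StrictMono n)
    (c : ℕ → ℝ)
    (hcone : ∀ j r : ℕ, 1 ≤ j → 1 ≤ r →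
      blockSigma ρ lam n c (j + r) ≤
        ENNReal.ofReal (a * b ^ r) * blockSigma ρ lam n c j)
    (j : ℕ) (hj : 1 ≤ j) :
    lpNorm τ {i | n j ≤ i} c ≤
      ENNReal.ofReal a * blockSigma ρ lam n c j *
        (∑' r : ℕ,
            (ENNReal.ofReal (b ^ (r + 1)) * blockLam ρ' lam n (j + r + 1)) ^
              τ.toReal) ^ (1 / τ.toReal) := by
  have hτfin : τ ≠ ∞ := ne_top_of_le_ne_top hρfin hτρ
  have hτ0 : τ ≠ 0 := (zero_lt_one.trans_le hτ).ne'
  have ht : 0 < τ.toReal := ENNReal.toReal_pos hτ0 hτfin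
  have hblock : ∀ m, {i | n (m - 1) ≤ i ∧ i < n m} =
      ((Finset.Ico (n (m - 1)) (n m) : Finset ℕ) : Set ℕ) := by
    intro m; ext i; simp
  have hcov : {i | n j ≤ i} ⊆
      ⋃ r : ℕ, {i | n (j + r + 1 - 1) ≤ i ∧ i < n (j + r + 1)} := by
    intro i hi
    have hex : ∃ r, i < n (j + r + 1) :=
      ⟨i, lt_of_lt_of_le (show i < j + i + 1 by omega) (hmono.id_le (j + i + 1))⟩
    rw [Set.mem_iUnion]
    classical
    refine ⟨Nat.find hex, ?_, Nat.find_spec hex⟩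
    rw [Nat.add_sub_cancel]
    rcases h : Nat.find hex with _ | m
    · simpa using hi
    · exact not_lt.mp (Nat.find_min hex (m := m) (by omega))
  rw [lpNorm_rpow hτ0 hτfin, one_div, ENNReal.rpow_inv_le_iff ht,
    ENNReal.mul_rpow_of_nonneg _ _ ht.le, ENNReal.rpow_inv_rpow ht.ne', ← ENNReal.tsum_mul_left]
  refine (ENNReal.tsum_mono_subtype (fun k => (‖c k‖₊ : ℝ≥0∞) ^ τ.toReal) hcov).trans ?_
  refine (ENNReal.tsum_iUnion_le_tsum (fun k => (‖c k‖₊ : ℝ≥0∞) ^ τ.toReal) _).trans ?_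
  refine ENNReal.tsum_le_tsum fun r => ?_
  have h1 := block_holder τ ρ ρ' hτ hτρ hρfin hconj lam c hpos
    (Finset.Ico (n (j + r + 1 - 1)) (n (j + r + 1)))
  rw [← hblock] at h1
  rw [hblock, Finset.tsum_subtype' _ (fun k => (‖c k‖₊ : ℝ≥0∞) ^ τ.toReal)]
  refine h1.trans ?_
  rw [← ENNReal.mul_rpow_of_nonneg _ _ ht.le]
  refine ENNReal.rpow_le_rpow ?_ ht.le
  have h2 := hcone j (r + 1) hj (by omega)
  rw [ENNReal.ofReal_mul (by linarith)] at h2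
  calc _ = blockSigma ρ lam n c (j + (r + 1)) * blockLam ρ' lam n (j + r + 1) := rfl
    _ ≤ _ := mul_le_mul_left h2 _
    _ = _ := by ring
end
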